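/- arXiv:2208.13060 — 6 statements merged into one kernel-verified Lean document; each statement's English description precedes it below -/
import Mathlib

section
/- Let h and k be coprime integers with k ≥ 1 and q₁q₂ | k. Then for every positive integer α, S_{χ₁,χ₂}(αh, αk) = S_{χ₁,χ₂}(h, k). -/
open scoped BigOperators

/-- The sawtooth (first Bernoulli) function `B₁`. -/
noncomputable def sawtooth (x : ℝ) : ℝ :=
  open scoped Classical in
  if ∃ n : ℤ, x = (n : ℝ) then 0 else x - ⌊x⌋ - 1 / 2

/-- The newform Dedekind sum `S_{χ₁,χ₂}(h,k)`. -/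
noncomputable def newformDedekindSum {q₁ q₂ : ℕ} (χ₁ : DirichletCharacter ℂ q₁)
    (χ₂ : DirichletCharacter ℂ q₂) (h k : ℤ) : ℂ :=
  ∑ j ∈ Finset.range k.toNat, ∑ n ∈ Finset.range q₁,
    (starRingEnd ℂ) (χ₂ (j : ZMod q₂)) * (starRingEnd ℂ) (χ₁ (n : ZMod q₁)) *
      (sawtooth ((j : ℝ) / (k : ℝ)) : ℝ) *
      (sawtooth ((n : ℝ) / (q₁ : ℝ) + (h : ℝ) * (j : ℝ) / (k : ℝ)) : ℝ)

theorem Finset.sum_range_mul_eq_sum_sum {M : Type*} [AddCommMonoid M] (f : ℕ → M) (m k : ℕ) :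
    ∑ j ∈ Finset.range (m * k), f j =
      ∑ a ∈ Finset.range k, ∑ b ∈ Finset.range m, f (a + k * b) := by
  rw [Finset.sum_comm]
  induction m with
  | zero => simp
  | succ m ih =>
    rw [Nat.succ_mul, Finset.sum_range_add, ih, Finset.sum_range_succ]
    simp only [Nat.mul_comm m k, Nat.add_comm]

theorem sawtooth_add_int (x : ℝ) (m : ℤ) : sawtooth (x + m) = sawtooth x := by
  have hiff : (∃ n : ℤ, x + m = n) ↔ ∃ n : ℤ, x = n :=
    ⟨fun ⟨n, hn⟩ => ⟨n - m, by push_cast; linarith⟩,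
      fun ⟨n, hn⟩ => ⟨n + m, by push_cast; linarith⟩⟩
  unfold sawtooth
  rw [Int.floor_add_intCast, Int.cast_add, add_sub_add_right_eq_sub]
  by_cases hx : ∃ n : ℤ, x = n
  · rw [if_pos hx, if_pos (hiff.2 hx)]
  · rw [if_neg hx, if_neg (hiff.not.2 hx)]

theorem sawtooth_zero : sawtooth 0 = 0 :=
  if_pos ⟨0, by simp⟩

theorem sawtooth_of_pos_of_lt_one {x : ℝ} (h0 : 0 < x) (h1 : x < 1) :
    sawtooth x = x - 1 / 2 := by
  have hfloor : ⌊x⌋ = 0 := Int.floor_eq_zero_iff.2 ⟨h0.le, h1⟩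
  have hne : ¬ ∃ n : ℤ, x = n := by
    rintro ⟨n, rfl⟩
    norm_cast at h0 h1
    omega
  simp [sawtooth, hne, hfloor]

theorem sum_range_div_sub_half (x : ℝ) {m : ℕ} (hm : 0 < m) :
    ∑ b ∈ Finset.range m, ((x + b) / m - 1 / 2) = x - 1 / 2 := by
  have hm' : (m : ℝ) ≠ 0 := by positivity
  have hsum : ∀ n : ℕ, ∑ b ∈ Finset.range n, (b : ℝ) = n * (n - 1) / 2 := fun n => by
    induction n with
    | zero => simp
    | succ n ih => rw [Finset.sum_range_succ, ih]; push_cast; ring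
  rw [Finset.sum_sub_distrib, ← Finset.sum_div, Finset.sum_add_distrib, hsum]
  simp only [Finset.sum_const, Finset.card_range, nsmul_eq_mul]
  field_simp
  ring

/-- The distribution relation of the sawtooth function on `[0, 1)`. -/
theorem sum_sawtooth_add_div {x : ℝ} (h0 : 0 ≤ x) (h1 : x < 1) {m : ℕ} (hm : 0 < m) :
    ∑ b ∈ Finset.range m, sawtooth ((x + b) / m) = sawtooth x := by
  have hm' : (0 : ℝ) < m := by exact_mod_cast hm
  have key : ∀ b ∈ Finset.range m, 0 < x + b →
      sawtooth ((x + b) / m) = (x + b) / m - 1 / 2 := fun b hb hpos => by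
    have hbm : (b : ℝ) + 1 ≤ m := by exact_mod_cast Finset.mem_range.1 hb
    exact sawtooth_of_pos_of_lt_one (by positivity) ((div_lt_one hm').2 (by linarith))
  rcases h0.eq_or_lt with rfl | hx
  · have hsum := sum_range_div_sub_half 0 hm
    obtain ⟨m, rfl⟩ := Nat.exists_eq_succ_of_ne_zero hm.ne'
    rw [Finset.sum_range_succ'] at hsum ⊢
    have hcongr := Finset.sum_congr (rfl : Finset.range m = Finset.range m) fun b hb =>
      key (b + 1) (by simpa using hb) (by positivity)
    rw [hcongr]
    simp only [Nat.cast_zero, add_zero, zero_div, sawtooth_zero] at hsum ⊢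
    linarith
  · rw [Finset.sum_congr rfl fun b hb => key b hb (by positivity), sum_range_div_sub_half x hm,
      sawtooth_of_pos_of_lt_one hx h1]

/-- Scaling invariance: for coprime `h, k` with `k ≥ 1` and `q₁q₂ ∣ k`, and any positive
integer `α`, one has `S_{χ₁,χ₂}(αh, αk) = S_{χ₁,χ₂}(h, k)`. -/
theorem newformDedekindSum_scale {q₁ q₂ : ℕ} (hq₁ : 1 < q₁) (hq₂ : 1 < q₂)
    (χ₁ : DirichletCharacter ℂ q₁) (χ₂ : DirichletCharacter ℂ q₂)
    (hχ₁ : DirichletCharacter.IsPrimitive χ₁) (hχ₂ : DirichletCharacter.IsPrimitive χ₂)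
    (hpar : χ₁ (-1) * χ₂ (-1) = 1)
    (h k : ℤ) (hcop : IsCoprime h k) (hk : 1 ≤ k) (hdvd : ((q₁ * q₂ : ℕ) : ℤ) ∣ k)
    (α : ℤ) (hα : 0 < α) :
    newformDedekindSum χ₁ χ₂ (α * h) (α * k) = newformDedekindSum χ₁ χ₂ h k := by
  lift k to ℕ using by omega
  lift α to ℕ using hα.le
  have hk0 : 0 < k := by omega
  have hα0 : 0 < α := by omega
  have hkR : (k : ℝ) ≠ 0 := by positivity
  have hαR : (α : ℝ) ≠ 0 := by positivity
  have hkq : (k : ZMod q₂) = 0 :=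
    (ZMod.natCast_eq_zero_iff _ _).2 ((Dvd.intro_left _ rfl).trans (Int.natCast_dvd_natCast.1 hdvd))
  unfold newformDedekindSum
  rw [← Nat.cast_mul, Int.toNat_natCast, Int.toNat_natCast, Finset.sum_range_mul_eq_sum_sum]
  refine Finset.sum_congr rfl fun a ha => ?_
  rw [Finset.sum_comm]
  refine Finset.sum_congr rfl fun n _ => ?_
  have hdist := sum_sawtooth_add_div (x := (a : ℝ) / k) (by positivity)
    ((div_lt_one (by positivity)).2 (by exact_mod_cast Finset.mem_range.1 ha)) hα0
  push_cast
  rw [← hdist, Complex.ofReal_sum, Finset.mul_sum, Finset.sum_mul]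
  refine Finset.sum_congr rfl fun b _ => ?_
  have hfst : ((a : ℝ) + k * b) / (α * k) = ((a : ℝ) / k + b) / α := by
    field_simp
  have hsnd : (n : ℝ) / q₁ + α * h * (a + k * b) / (α * k) =
      (n : ℝ) / q₁ + h * a / k + ((h * b : ℤ) : ℝ) := by
    push_cast
    field_simp
    ring
  rw [hfst, hsnd, sawtooth_add_int, hkq, zero_mul, add_zero]
end

section
/- Let q, q′ ≥ 1 and let (χ₁, χ₁′) and (χ₂, χ₂′) be two distinct ordered pairs, where χ₁, χ₂ are Dirichlet characters modulo q and χ₁′, χ₂′ are Dirichlet characters modulo q′. Then there exists a positive integer n such that ρ_{χ₁,χ₁′}(n) ≠ ρ_{χ₂,χ₂′}(n). (Consequently, for any finite set of distinct ordered pairs of characters modulo q and q′, there exist n and two indices i ≠ j with ρ_{χ_i,χ_i′}(n) ≠ ρ_{χ_j,χ_j′}(n).) -/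
open scoped BigOperators

/-- `ρ_{χ,χ'}(n) = Σ_{d ∣ n} χ(n/d) χ̄'(d) d`. -/
noncomputable def rhoCoeff {q q' : ℕ} (χ : DirichletCharacter ℂ q)
    (χ' : DirichletCharacter ℂ q') (n : ℕ) : ℂ :=
  ∑ p ∈ Nat.divisorsAntidiagonal n,
    χ ((p.1 : ℤ) : ZMod q) * (starRingEnd ℂ) (χ' ((p.2 : ℤ) : ZMod q')) * (p.2 : ℂ)

theorem rhoCoeff_prime {q q' : ℕ} (χ : DirichletCharacter ℂ q) (χ' : DirichletCharacter ℂ q')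
    {p : ℕ} (hp : p.Prime) :
    rhoCoeff χ χ' p = χ (p : ZMod q) + (starRingEnd ℂ) (χ' (p : ZMod q')) * p := by
  unfold rhoCoeff
  rw [Nat.sum_divisorsAntidiagonal
    (f := fun a b ↦ χ ((a : ℤ) : ZMod q) * (starRingEnd ℂ) (χ' ((b : ℤ) : ZMod q')) * (b : ℂ)),
    hp.sum_divisors]
  simp [Nat.div_self hp.pos]

/-- The second character is determined by the values of `ρ` at primes, since there its
contribution grows linearly while that of the first character is bounded. -/
theorem eq_right_of_rhoCoeff_prime_eq {q q' : ℕ} [NeZero q'] {χ₁ χ₂ : DirichletCharacter ℂ q}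
    {χ₁' χ₂' : DirichletCharacter ℂ q'}
    (h : ∀ p : ℕ, p.Prime → rhoCoeff χ₁ χ₁' p = rhoCoeff χ₂ χ₂' p) : χ₁' = χ₂' := by
  refine MulChar.ext fun b ↦ ?_
  by_contra hb
  have hpos : 0 < ‖χ₁' b - χ₂' b‖ := norm_pos_iff.mpr (sub_ne_zero.mpr hb)
  obtain ⟨N, hN⟩ := exists_nat_gt (2 / ‖χ₁' b - χ₂' b‖)
  obtain ⟨p, hNp, hp, hpb⟩ := Nat.forall_exists_prime_gt_and_eq_mod b.isUnit N
  have hρ := h p hp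
  rw [rhoCoeff_prime _ _ hp, rhoCoeff_prime _ _ hp, hpb] at hρ
  have hdiff : (starRingEnd ℂ) (χ₁' b - χ₂' b) * p = χ₂ (p : ZMod q) - χ₁ (p : ZMod q) := by
    rw [map_sub]
    linear_combination hρ
  have hle : ‖χ₁' b - χ₂' b‖ * p ≤ 2 := by
    calc ‖χ₁' b - χ₂' b‖ * p = ‖χ₂ (p : ZMod q) - χ₁ (p : ZMod q)‖ := by
          rw [← hdiff, norm_mul, RCLike.norm_conj, Complex.norm_natCast]
      _ ≤ ‖χ₂ (p : ZMod q)‖ + ‖χ₁ (p : ZMod q)‖ := norm_sub_le _ _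
      _ ≤ 2 := by linarith [χ₁.norm_le_one (p : ZMod q), χ₂.norm_le_one (p : ZMod q)]
  rw [div_lt_iff₀ hpos] at hN
  have hNp' : (N : ℝ) < p := by exact_mod_cast hNp
  nlinarith

theorem eq_left_of_rhoCoeff_prime_eq {q q' : ℕ} [NeZero q] {χ₁ χ₂ : DirichletCharacter ℂ q}
    {χ' : DirichletCharacter ℂ q'}
    (h : ∀ p : ℕ, p.Prime → rhoCoeff χ₁ χ' p = rhoCoeff χ₂ χ' p) : χ₁ = χ₂ := by
  refine MulChar.ext fun a ↦ ?_
  obtain ⟨p, -, hp, hpa⟩ := Nat.forall_exists_prime_gt_and_eq_mod a.isUnit 0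
  have hρ := h p hp
  rwa [rhoCoeff_prime _ _ hp, rhoCoeff_prime _ _ hp, hpa, add_left_inj] at hρ

/-- Distinct ordered pairs of Dirichlet characters modulo `q` and `q'` are separated by the
coefficients `ρ`: there is a positive integer `n` with `ρ_{χ₁,χ₁'}(n) ≠ ρ_{χ₂,χ₂'}(n)`. -/
theorem rho_separates_pairs {q q' : ℕ} (hq : 1 ≤ q) (hq' : 1 ≤ q')
    (χ₁ χ₂ : DirichletCharacter ℂ q) (χ₁' χ₂' : DirichletCharacter ℂ q')
    (hne : (χ₁, χ₁') ≠ (χ₂, χ₂')) :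
    ∃ n : ℕ, 0 < n ∧ rhoCoeff χ₁ χ₁' n ≠ rhoCoeff χ₂ χ₂' n := by
  have : NeZero q := ⟨by lia⟩
  have : NeZero q' := ⟨by lia⟩
  by_contra! h
  have hprime (p : ℕ) (hp : p.Prime) : rhoCoeff χ₁ χ₁' p = rhoCoeff χ₂ χ₂' p := h p hp.pos
  obtain rfl := eq_right_of_rhoCoeff_prime_eq hprime
  obtain rfl := eq_left_of_rhoCoeff_prime_eq hprime
  exact hne rfl
end

section
/- The image S_{χ₁,χ₂}(Γ₁(q₁q₂)) = {S_{χ₁,χ₂}(γ) : γ ∈ Γ₁(q₁q₂)} is an additive subgroup of ℂ which is a finitely generated free abelian group (a free ℤ-module of finite rank). -/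
open scoped BigOperators

/-- The newform Dedekind sum of a matrix `γ`, via its left column. -/
noncomputable def SGamma {q₁ q₂ : ℕ} (χ₁ : DirichletCharacter ℂ q₁)
    (χ₂ : DirichletCharacter ℂ q₂) (γ : Matrix.SpecialLinearGroup (Fin 2) ℤ) : ℂ :=
  if 0 < (γ : Matrix (Fin 2) (Fin 2) ℤ) 1 0 then
    newformDedekindSum χ₁ χ₂ ((γ : Matrix (Fin 2) (Fin 2) ℤ) 0 0)
      ((γ : Matrix (Fin 2) (Fin 2) ℤ) 1 0)
  else if (γ : Matrix (Fin 2) (Fin 2) ℤ) 1 0 < 0 then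
    newformDedekindSum χ₁ χ₂ (-(γ : Matrix (Fin 2) (Fin 2) ℤ) 0 0)
      (-(γ : Matrix (Fin 2) (Fin 2) ℤ) 1 0)
  else 0

lemma sawtooth_eq_fract (x : ℝ) : sawtooth x = (Int.fract x - Int.fract (-x)) / 2 := by
  unfold sawtooth
  split_ifs with h
  · obtain ⟨n, rfl⟩ := h
    rw [← Int.cast_neg, Int.fract_intCast, Int.fract_intCast]; simp
  · have hx : Int.fract x ≠ 0 := fun h0 => h ⟨⌊x⌋, by
      have := Int.self_sub_floor x; linarith⟩
    rw [Int.fract_neg hx, Int.self_sub_floor]; ring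

lemma sawtooth_neg (x : ℝ) : sawtooth (-x) = -sawtooth x := by
  rw [sawtooth_eq_fract, sawtooth_eq_fract, neg_neg]; ring

lemma sawtooth_add_intCast (x : ℝ) (n : ℤ) : sawtooth (x + n) = sawtooth x := by
  rw [sawtooth_eq_fract, sawtooth_eq_fract, neg_add, ← Int.cast_neg, Int.fract_add_intCast,
    Int.fract_add_intCast]

lemma sum_fract_add_div (n : ℕ) (hn : 0 < n) (x : ℝ) :
    ∑ t ∈ Finset.range n, Int.fract (x + t / n) = Int.fract (n * x) + (n - 1) / 2 := by
  have hn' : (0 : ℝ) < n := by exact_mod_cast hn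
  have hstep : Function.Periodic
      (fun x : ℝ => ∑ t ∈ Finset.range n, Int.fract (x + t / n) - Int.fract (n * x))
      (1 / n : ℝ) := by
    intro x
    have h1 : Int.fract (n * (x + 1 / n)) = Int.fract (n * x) := by
      rw [mul_add, mul_one_div_cancel hn'.ne']; exact Int.fract_add_one _
    have h2 := Finset.sum_range_succ (fun t : ℕ => Int.fract (x + (t : ℝ) / n)) n
    rw [Finset.sum_range_succ', div_self hn'.ne', Int.fract_add_one] at h2
    simp only [Nat.cast_zero, zero_div, add_zero, add_left_inj] at h2
    simp only [h1, ← h2]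
    congr 1
    refine Finset.sum_congr rfl fun t _ => ?_
    congr 1
    push_cast
    ring
  obtain ⟨y, hy, hxy⟩ := hstep.exists_mem_Ico₀ (by positivity) x
  obtain ⟨hy0, hy1⟩ := hy
  rw [lt_div_iff₀ hn'] at hy1
  have h3 : Int.fract (n * y) = n * y := Int.fract_eq_self.2 ⟨by positivity, by linarith⟩
  have h4 : ∑ t ∈ Finset.range n, Int.fract (y + t / n)
      = ∑ t ∈ Finset.range n, (y + t / n) := by
    refine Finset.sum_congr rfl fun t ht => Int.fract_eq_self.2 ⟨by positivity, ?_⟩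
    have : (t : ℝ) + 1 ≤ n := by exact_mod_cast Finset.mem_range.1 ht
    rw [← sub_pos]
    have : 1 - (y + t / n) = (n - t - y * n) / n := by field_simp; ring
    rw [this]
    exact div_pos (by linarith) hn'
  have h5 : ∑ t ∈ Finset.range n, (t : ℝ) = n * (n - 1) / 2 := by
    clear * -
    induction n with
    | zero => simp
    | succ k ih => rw [Finset.sum_range_succ, ih]; push_cast; ring
  rw [h3, h4, Finset.sum_add_distrib, ← Finset.sum_div, h5] at hxy
  simp only [Finset.sum_const, Finset.card_range, nsmul_eq_mul] at hxy
  have h6 : (n : ℝ) * (n - 1) / 2 / n = (n - 1) / 2 := by field_simp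
  rw [h6] at hxy
  linarith

lemma sum_sawtooth_add_div_s9 (n : ℕ) (hn : 0 < n) (x : ℝ) :
    ∑ t ∈ Finset.range n, sawtooth (x + t / n) = sawtooth (n * x) := by
  have hn' : (n : ℝ) ≠ 0 := by exact_mod_cast hn.ne'
  have h1 : ∑ t ∈ Finset.range n, Int.fract (-(x + (t : ℝ) / n))
      = ∑ t ∈ Finset.range n, Int.fract (-x - (n - 1) / n + (t : ℝ) / n) := by
    rw [← Finset.sum_range_reflect]
    refine Finset.sum_congr rfl fun t ht => ?_
    have ht := Finset.mem_range.1 ht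
    rw [Nat.cast_sub (by omega), Nat.cast_sub (by omega)]
    congr 1
    push_cast
    ring
  have h2 : Int.fract (n * (-x - (n - 1) / n)) = Int.fract (-(n * x)) := by
    rw [show (n : ℝ) * (-x - (n - 1) / n) = -(n * x) - ((n - 1 : ℤ) : ℝ) by
      push_cast; field_simp, Int.fract_sub_intCast]
  simp only [sawtooth_eq_fract]
  rw [← Finset.sum_div, Finset.sum_sub_distrib, h1, sum_fract_add_div n hn,
    sum_fract_add_div n hn, h2]
  ring

/-- The sawtooth function on `(1/M)ℤ/ℤ`, identified with `ZMod M`. -/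
noncomputable def zmodSawtooth {M : ℕ} (x : ZMod M) : ℝ := sawtooth ((x.val : ℝ) / M)

lemma zmodSawtooth_intCast {M : ℕ} [NeZero M] (i : ℤ) :
    zmodSawtooth (i : ZMod M) = sawtooth ((i : ℝ) / M) := by
  have hM : (M : ℝ) ≠ 0 := by exact_mod_cast NeZero.ne M
  have h1 : (((i : ZMod M).val : ℤ) : ℝ) = ((i % M : ℤ) : ℝ) := by rw [ZMod.val_intCast]
  have h2 : (i : ℝ) = ((i % M : ℤ) : ℝ) + M * ((i / M : ℤ) : ℝ) := by
    exact_mod_cast (Int.emod_add_mul_ediv i M).symm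
  rw [zmodSawtooth, ← sawtooth_add_intCast _ (i / M)]
  congr 1
  rw [h2, ← h1]
  push_cast
  field_simp

lemma zmodSawtooth_neg {M : ℕ} [NeZero M] (x : ZMod M) :
    zmodSawtooth (-x) = -zmodSawtooth x := by
  obtain ⟨i, rfl⟩ := ZMod.intCast_surjective x
  rw [← Int.cast_neg, zmodSawtooth_intCast, zmodSawtooth_intCast, Int.cast_neg, neg_div,
    sawtooth_neg]

lemma sum_zmodSawtooth_fiber_nat {M : ℕ} [NeZero M] (n : ℕ) (hn : n ∣ M) (y : ZMod M) :
    (∑ x : ZMod M, if (n : ZMod M) * x = n * y then zmodSawtooth x else 0)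
      = zmodSawtooth ((n : ZMod M) * y) := by
  obtain ⟨r, hr⟩ := hn
  have hM0 : M ≠ 0 := NeZero.ne M
  have hn0 : 0 < n := Nat.pos_of_ne_zero fun h => hM0 (by simp [hr, h])
  have hr0 : 0 < r := Nat.pos_of_ne_zero fun h => hM0 (by simp [hr, h])
  have hn' : (n : ℝ) ≠ 0 := by exact_mod_cast hn0.ne'
  have hr' : (r : ℝ) ≠ 0 := by exact_mod_cast hr0.ne'
  obtain ⟨i, rfl⟩ := ZMod.intCast_surjective y
  have hR : zmodSawtooth ((n : ZMod M) * (i : ZMod M)) = sawtooth (n * ((i : ℝ) / M)) := by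
    rw [show (n : ZMod M) * (i : ZMod M) = ((n * i : ℤ) : ZMod M) by push_cast; rfl,
      zmodSawtooth_intCast]
    push_cast
    rw [mul_div_assoc]
  rw [hR, ← sum_sawtooth_add_div_s9 n hn0, ← Finset.sum_filter]
  symm
  refine Finset.sum_bij (fun t _ => ((i + t * r : ℤ) : ZMod M)) ?_ ?_ ?_ ?_
  · intro t _
    simp only [Finset.mem_filter, Finset.mem_univ, true_and]
    have : ((n * r : ℕ) : ZMod M) = 0 := by rw [← hr]; simp
    push_cast at this ⊢
    linear_combination (t : ZMod M) * this
  · intro s hs t ht hst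
    rw [ZMod.intCast_eq_intCast_iff_dvd_sub, hr] at hst
    push_cast at hst
    rw [show (i + t * r - (i + s * r) : ℤ) = (t - s) * r by ring] at hst
    have h := Int.dvd_of_mul_dvd_mul_right (by exact_mod_cast hr0.ne') hst
    have hs := Finset.mem_range.1 hs
    have ht := Finset.mem_range.1 ht
    have := Int.eq_zero_of_abs_lt_dvd h (by rw [abs_lt]; constructor <;> omega)
    omega
  · intro x hx
    simp only [Finset.mem_filter, Finset.mem_univ, true_and] at hx
    obtain ⟨j, rfl⟩ := ZMod.intCast_surjective x
    rw [show (n : ZMod M) * (i : ZMod M) = ((n * i : ℤ) : ZMod M) by push_cast; rfl,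
      show (n : ZMod M) * (j : ZMod M) = ((n * j : ℤ) : ZMod M) by push_cast; rfl, eq_comm,
      ZMod.intCast_eq_intCast_iff_dvd_sub, hr] at hx
    push_cast at hx
    rw [← mul_sub] at hx
    obtain ⟨s, hs⟩ := Int.dvd_of_mul_dvd_mul_left (by exact_mod_cast hn0.ne') hx
    have hs0 : 0 ≤ s % n := Int.emod_nonneg _ (by omega)
    have hs1 : s % n < n := Int.emod_lt_of_pos _ (by omega)
    refine ⟨(s % n).toNat, Finset.mem_range.2 (by omega), ?_⟩
    rw [ZMod.intCast_eq_intCast_iff_dvd_sub, hr, Int.toNat_of_nonneg hs0]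
    refine ⟨s / n, ?_⟩
    have := Int.emod_add_mul_ediv s n
    push_cast
    linear_combination hs - (r : ℤ) * this
  · intro t _
    rw [zmodSawtooth_intCast, hr]
    congr 1
    push_cast
    field_simp

lemma sum_zmodSawtooth_fiber {M : ℕ} [NeZero M] (b : ℤ) (hb : b ∣ M) (y : ZMod M) :
    (∑ x : ZMod M, if (b : ZMod M) * x = b * y then zmodSawtooth x else 0)
      = b.sign * zmodSawtooth ((b : ZMod M) * y) := by
  have hb0 : b ≠ 0 := fun h => NeZero.ne M (by simpa [h] using hb)
  refine (Finset.sum_congr rfl fun x _ => ?_).trans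
    ((sum_zmodSawtooth_fiber_nat b.natAbs (Int.natAbs_dvd_natAbs.2 hb) y).trans ?_)
  · refine if_congr ?_ rfl rfl
    rcases Int.natAbs_eq b with h | h <;> nth_rw 1 2 [h] <;> simp
  · rcases lt_or_gt_of_ne hb0 with h | h
    · have hc : ((b.natAbs : ℕ) : ZMod M) = -(b : ZMod M) := by
        rw [← Int.cast_natCast, Int.ofNat_natAbs_of_nonpos h.le, Int.cast_neg]
      rw [hc, neg_mul, zmodSawtooth_neg, Int.sign_eq_neg_one_of_neg h]
      simp
    · have hc : ((b.natAbs : ℕ) : ZMod M) = (b : ZMod M) := by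
        rw [← Int.cast_natCast, Int.natAbs_of_nonneg h.le]
      rw [hc, Int.sign_eq_one_of_pos h]
      simp

/-- Half the negative of the second Bernoulli function on `(1/M)ℤ/ℤ`. -/
noncomputable def zmodBernoulliTwo {M : ℕ} (x : ZMod M) : ℝ :=
  -(((x.val : ℝ) / M) ^ 2 - (x.val : ℝ) / M + 1 / 6) / 2

lemma zmodSawtooth_eq {M : ℕ} [NeZero M] (x : ZMod M) :
    zmodSawtooth x = if x = 0 then 0 else (x.val : ℝ) / M - 1 / 2 := by
  have hM : (0 : ℝ) < M := by exact_mod_cast Nat.pos_of_ne_zero (NeZero.ne M)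
  split_ifs with h
  · subst h
    rw [zmodSawtooth, sawtooth_eq_fract]; simp
  · have hx : (x.val : ℝ) / M < 1 := (div_lt_one hM).2 (by exact_mod_cast x.val_lt)
    have hf : Int.fract ((x.val : ℝ) / M) = (x.val : ℝ) / M :=
      Int.fract_eq_self.2 ⟨by positivity, hx⟩
    have h0 : (x.val : ℝ) / M ≠ 0 :=
      div_ne_zero (by exact_mod_cast (ZMod.val_ne_zero x).2 h) hM.ne'
    rw [zmodSawtooth, sawtooth_eq_fract, Int.fract_neg (by rwa [hf]), hf]
    ring

lemma zmodSawtooth_three_term {M : ℕ} [NeZero M] {x y z : ZMod M} (h : x + y + z = 0)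
    (hne : ¬ (x = 0 ∧ y = 0)) :
    zmodSawtooth x * zmodSawtooth y + zmodSawtooth y * zmodSawtooth z
      + zmodSawtooth z * zmodSawtooth x
      = zmodBernoulliTwo x + zmodBernoulliTwo y + zmodBernoulliTwo z := by
  have hM : 0 < M := Nat.pos_of_ne_zero (NeZero.ne M)
  have hM' : (M : ℝ) ≠ 0 := by exact_mod_cast hM.ne'
  have hx := x.val_lt
  have hy := y.val_lt
  have hz := z.val_lt
  have hd : M ∣ x.val + y.val + z.val := by
    rw [← ZMod.natCast_eq_zero_iff]
    simpa using h
  have hs : x.val + y.val + z.val = 0 ∨ x.val + y.val + z.val = M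
      ∨ x.val + y.val + z.val = 2 * M := by
    obtain ⟨k, hk⟩ := hd
    have : k < 3 := by
      by_contra hk3
      have := Nat.mul_le_mul_left M (not_lt.1 hk3)
      omega
    interval_cases k <;> omega
  have hs' : (x.val + y.val + z.val = 0) ∨ (x.val : ℝ) / M + y.val / M + z.val / M = 1
      ∨ (x.val : ℝ) / M + y.val / M + z.val / M = 2 := by
    rcases hs with hs | hs | hs
    · exact Or.inl hs
    · refine Or.inr (Or.inl ?_)
      rw [← add_div, ← add_div, div_eq_one_iff_eq hM']
      exact_mod_cast hs
    · refine Or.inr (Or.inr ?_)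
      rw [← add_div, ← add_div, div_eq_iff hM']
      exact_mod_cast hs
  have e1 := ZMod.val_eq_zero x
  have e2 := ZMod.val_eq_zero y
  have e3 := ZMod.val_eq_zero z
  rw [← e1, ← e2] at hne
  simp only [zmodSawtooth_eq, zmodBernoulliTwo, ← e1, ← e2, ← e3]
  rcases hs' with h0 | h0
  · exact absurd ⟨by omega, by omega⟩ hne
  · have hz' : (z.val : ℝ) / M = 1 - x.val / M - y.val / M
        ∨ (z.val : ℝ) / M = 2 - x.val / M - y.val / M := by
      rcases h0 with h0 | h0
      · left; linarith
      · right; linarith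
    split_ifs with h1 h2 h3 h3 h2 h3 h3
    · exact absurd ⟨h1, h2⟩ hne
    · exact absurd ⟨h1, h2⟩ hne
    · have : y.val = M ∨ y.val = 2 * M := by omega
      omega
    · have : (y.val : ℝ) / M = 1 - z.val / M := by
        rw [h1] at hs
        rw [eq_sub_iff_add_eq, ← add_div, div_eq_one_iff_eq hM']
        exact_mod_cast (by omega : y.val + z.val = M)
      rw [h1, this]; push_cast; ring
    · omega
    · have : (x.val : ℝ) / M = 1 - z.val / M := by
        rw [eq_sub_iff_add_eq, ← add_div, div_eq_one_iff_eq hM']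
        exact_mod_cast (by omega : x.val + z.val = M)
      rw [h2, this]; push_cast; ring
    · have : (x.val : ℝ) / M = 1 - y.val / M := by
        rw [eq_sub_iff_add_eq, ← add_div, div_eq_one_iff_eq hM']
        exact_mod_cast (by omega : x.val + y.val = M)
      rw [h3, this]; push_cast; ring
    · rcases hz' with h | h <;> rw [h] <;> ring

lemma sum_comp_mul_zmodSawtooth {M : ℕ} [NeZero M] (a : ℤ) (ha : a ∣ M) (G : ZMod M → ℂ)
    (hG : ∀ y, G y ≠ 0 → (a : ZMod M) ∣ y) :
    ∑ x : ZMod M, G (a * x) * (zmodSawtooth x : ℂ)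
      = (a.sign : ℂ) * ∑ y : ZMod M, G y * (zmodSawtooth y : ℂ) := by
  have h1 : ∀ x : ZMod M, G (a * x) * (zmodSawtooth x : ℂ)
      = ∑ y : ZMod M, G y * ((if (a : ZMod M) * x = y then zmodSawtooth x else 0 : ℝ) : ℂ) := by
    intro x
    rw [Finset.sum_eq_single ((a : ZMod M) * x)]
    · simp
    · intro y _ hy
      simp [Ne.symm hy]
    · simp
  simp only [h1]
  rw [Finset.sum_comm, Finset.mul_sum]
  refine Finset.sum_congr rfl fun y _ => ?_
  rw [← Finset.mul_sum, ← Complex.ofReal_sum]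
  by_cases hy : G y = 0
  · simp [hy]
  · obtain ⟨z, rfl⟩ := hG y hy
    rw [sum_zmodSawtooth_fiber a ha z]
    push_cast
    ring

/-- The Dedekind-type sum attached to a weight `F` on the `M`-torsion points of the torus and a
pair of directions. -/
noncomputable def sawtoothPairing {M : ℕ} [NeZero M] (F : ZMod M × ZMod M → ℂ)
    (u v : ZMod M × ZMod M) : ℂ :=
  ∑ x : ZMod M, ∑ y : ZMod M, F (x • u + y • v) * ((zmodSawtooth x : ℂ) * zmodSawtooth y)

section Pairing

variable {M : ℕ} [NeZero M] (F : ZMod M × ZMod M → ℂ)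

lemma sawtoothPairing_comm (u v : ZMod M × ZMod M) :
    sawtoothPairing F u v = sawtoothPairing F v u := by
  unfold sawtoothPairing
  rw [Finset.sum_comm]
  refine Finset.sum_congr rfl fun x _ => Finset.sum_congr rfl fun y _ => ?_
  rw [add_comm, mul_comm (zmodSawtooth y : ℂ)]

lemma sawtoothPairing_neg_right (u v : ZMod M × ZMod M) :
    sawtoothPairing F u (-v) = -sawtoothPairing F u v := by
  unfold sawtoothPairing
  rw [← Finset.sum_neg_distrib]
  refine Finset.sum_congr rfl fun x _ => ?_
  rw [← Finset.sum_neg_distrib, ← Equiv.sum_comp (Equiv.neg _)]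
  refine Finset.sum_congr rfl fun y _ => ?_
  simp only [Equiv.neg_apply, zmodSawtooth_neg, smul_neg, neg_smul, neg_neg]
  push_cast
  ring

lemma sum_comp_smul_sawtooth {u v : ZMod M × ZMod M} {a b : ℤ} (ha : a ∣ M) (hb : b ∣ M)
    (hF : ∀ x y : ZMod M, F (x • u + y • v) ≠ 0 → (a : ZMod M) ∣ x ∧ (b : ZMod M) ∣ y) :
    ∑ x : ZMod M, ∑ y : ZMod M,
        F (((a : ZMod M) * x) • u + ((b : ZMod M) * y) • v)
          * ((zmodSawtooth x : ℂ) * zmodSawtooth y)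
      = (a.sign : ℂ) * b.sign * sawtoothPairing F u v := by
  have h1 : ∀ x : ZMod M, ∑ y : ZMod M, F (((a : ZMod M) * x) • u + ((b : ZMod M) * y) • v)
          * ((zmodSawtooth x : ℂ) * zmodSawtooth y)
      = ((b.sign : ℂ) * ∑ y : ZMod M, F (((a : ZMod M) * x) • u + y • v) * zmodSawtooth y)
        * zmodSawtooth x := by
    intro x
    rw [← sum_comp_mul_zmodSawtooth b hb (fun y => F (((a : ZMod M) * x) • u + y • v))
      (fun y hy => (hF _ _ hy).2), Finset.sum_mul]
    exact Finset.sum_congr rfl fun y _ => by ring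
  simp only [h1]
  rw [sum_comp_mul_zmodSawtooth a ha
    (fun x => (b.sign : ℂ) * ∑ y : ZMod M, F (x • u + y • v) * zmodSawtooth y)]
  · unfold sawtoothPairing
    rw [mul_assoc]
    congr 1
    rw [Finset.mul_sum]
    refine Finset.sum_congr rfl fun x _ => ?_
    rw [mul_assoc]
    congr 1
    rw [Finset.sum_mul]
    exact Finset.sum_congr rfl fun y _ => by ring
  · intro x hx
    by_contra hax
    refine hx ?_
    rw [Finset.sum_eq_zero, mul_zero]
    intro y _
    by_cases h : F (x • u + y • v) = 0
    · simp [h]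
    · exact absurd (hF _ _ h).1 hax

lemma sawtoothPairing_three_term {u v w : ZMod M × ZMod M} {a b c : ℤ}
    (ha : a ∣ M) (hb : b ∣ M) (hc : c ∣ M)
    (hrel : (a : ZMod M) • u + (b : ZMod M) • v + (c : ZMod M) • w = 0) (hF0 : F 0 = 0)
    (huv : ∀ x y : ZMod M, F (x • u + y • v) ≠ 0 → (a : ZMod M) ∣ x ∧ (b : ZMod M) ∣ y)
    (hvw : ∀ x y : ZMod M, F (x • v + y • w) ≠ 0 → (b : ZMod M) ∣ x ∧ (c : ZMod M) ∣ y)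
    (hwu : ∀ x y : ZMod M, F (x • w + y • u) ≠ 0 → (c : ZMod M) ∣ x ∧ (a : ZMod M) ∣ y)
    (hu : ∀ z, ∑ x : ZMod M, F (z + ((a : ZMod M) * x) • u) = 0)
    (hv : ∀ z, ∑ x : ZMod M, F (z + ((b : ZMod M) * x) • v) = 0)
    (hw : ∀ z, ∑ x : ZMod M, F (z + ((c : ZMod M) * x) • w) = 0) :
    (a.sign : ℂ) * b.sign * sawtoothPairing F u v + (b.sign : ℂ) * c.sign * sawtoothPairing F v w
      + (c.sign : ℂ) * a.sign * sawtoothPairing F w u = 0 := by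
  have reix : ∀ (x : ZMod M) (G : ZMod M → ℂ), ∑ y, G (-x - y) = ∑ y, G y := fun x G =>
    Equiv.sum_comp (Equiv.subLeft (-x)) G
  have hφ2 : ∀ x y : ZMod M, ((b : ZMod M) * x) • v + (((-a : ℤ) : ZMod M) * y) • u
      = ((c : ZMod M) * y) • w + (((-b : ℤ) : ZMod M) * (-x - y)) • v := by
    intro x y
    have : ((c : ZMod M) * y) • w = -(((a : ZMod M) * y) • u) - ((b : ZMod M) * y) • v := by
      rw [← sub_eq_zero]
      refine Eq.trans ?_ ((congrArg (y • ·) hrel).trans (smul_zero y))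
      module
    rw [this]; push_cast; module
  have hφ3 : ∀ x y : ZMod M, ((b : ZMod M) * x) • v + (((-a : ℤ) : ZMod M) * y) • u
      = ((a : ZMod M) * (-x - y)) • u + (((-c : ℤ) : ZMod M) * x) • w := by
    intro x y
    have : ((c : ZMod M) * x) • w = -(((a : ZMod M) * x) • u) - ((b : ZMod M) * x) • v := by
      rw [← sub_eq_zero]
      refine Eq.trans ?_ ((congrArg (x • ·) hrel).trans (smul_zero x))
      module
    push_cast
    rw [neg_mul, neg_smul, neg_mul, neg_smul, this]; module
  set φ : ZMod M → ZMod M → ZMod M × ZMod M :=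
    fun x y => ((b : ZMod M) * x) • v + (((-a : ℤ) : ZMod M) * y) • u with hφ
  have s1 : ∑ x, ∑ y, F (φ x y) * ((zmodSawtooth x : ℂ) * zmodSawtooth y)
      = (b.sign : ℂ) * (-a).sign * sawtoothPairing F v u := by
    refine sum_comp_smul_sawtooth F hb ((neg_dvd).2 ha) fun x y h => ?_
    rw [add_comm] at h
    push_cast
    rw [neg_dvd]
    exact (huv _ _ h).symm
  have s2 : ∑ x, ∑ y, F (φ x y) * ((zmodSawtooth y : ℂ) * zmodSawtooth (-x - y))
      = (c.sign : ℂ) * (-b).sign * sawtoothPairing F w v := by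
    rw [← sum_comp_smul_sawtooth F hc ((neg_dvd).2 hb), Finset.sum_comm]
    · refine Finset.sum_congr rfl fun y _ => ?_
      refine Eq.trans ?_ (reix y _)
      refine Finset.sum_congr rfl fun x _ => ?_
      simp only [hφ, hφ2]
      rw [show -y - x = -x - y by ring]
    · intro x y h
      rw [add_comm] at h
      push_cast
      rw [neg_dvd]
      exact (hvw _ _ h).symm
  have s3 : ∑ x, ∑ y, F (φ x y) * ((zmodSawtooth (-x - y) : ℂ) * zmodSawtooth x)
      = (a.sign : ℂ) * (-c).sign * sawtoothPairing F u w := by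
    rw [← sum_comp_smul_sawtooth F ha ((neg_dvd).2 hc), Finset.sum_comm (s := Finset.univ)]
    · rw [Finset.sum_comm]
      conv_rhs => rw [Finset.sum_comm]
      refine Finset.sum_congr rfl fun x _ => ?_
      refine Eq.trans ?_ (reix x _)
      refine Finset.sum_congr rfl fun y _ => ?_
      simp only [hφ, hφ3]
    · intro x y h
      rw [add_comm] at h
      push_cast
      rw [neg_dvd]
      exact (hwu _ _ h).symm
  have t1 : ∑ x, ∑ y, F (φ x y) * (zmodBernoulliTwo x : ℂ) = 0 := by
    refine Finset.sum_eq_zero fun x _ => ?_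
    rw [← Finset.sum_mul, ← Equiv.sum_comp (Equiv.neg _)]
    simp only [hφ, Equiv.neg_apply, Int.cast_neg, neg_mul_neg, hu, zero_mul]
  have t2 : ∑ x, ∑ y, F (φ x y) * (zmodBernoulliTwo y : ℂ) = 0 := by
    rw [Finset.sum_comm]
    refine Finset.sum_eq_zero fun y _ => ?_
    rw [← Finset.sum_mul]
    simp only [hφ, add_comm (((b : ZMod M) * _) • v), hv, zero_mul]
  have t3 : ∑ x, ∑ y, F (φ x y) * (zmodBernoulliTwo (-x - y) : ℂ) = 0 := by
    have : ∑ x, ∑ y, F (φ x y) * (zmodBernoulliTwo (-x - y) : ℂ)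
        = ∑ x, ∑ z, F (((a : ZMod M) * z) • u + (((-c : ℤ) : ZMod M) * x) • w)
            * (zmodBernoulliTwo z : ℂ) := by
      refine Finset.sum_congr rfl fun x _ => ?_
      refine Eq.trans ?_ (reix x _)
      refine Finset.sum_congr rfl fun y _ => ?_
      simp only [hφ, hφ3]
    rw [this, Finset.sum_comm]
    refine Finset.sum_eq_zero fun z _ => ?_
    rw [← Finset.sum_mul, ← Equiv.sum_comp (Equiv.neg _)]
    simp only [Equiv.neg_apply, Int.cast_neg, neg_mul_neg, hw, zero_mul]
  have key : ∑ x, ∑ y, F (φ x y) * ((zmodSawtooth x : ℂ) * zmodSawtooth y)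
      + ∑ x, ∑ y, F (φ x y) * ((zmodSawtooth y : ℂ) * zmodSawtooth (-x - y))
      + ∑ x, ∑ y, F (φ x y) * ((zmodSawtooth (-x - y) : ℂ) * zmodSawtooth x)
      = ∑ x, ∑ y, F (φ x y) * (zmodBernoulliTwo x : ℂ)
        + ∑ x, ∑ y, F (φ x y) * (zmodBernoulliTwo y : ℂ)
        + ∑ x, ∑ y, F (φ x y) * (zmodBernoulliTwo (-x - y) : ℂ) := by
    simp only [← Finset.sum_add_distrib]
    refine Finset.sum_congr rfl fun x _ => Finset.sum_congr rfl fun y _ => ?_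
    rw [← mul_add, ← mul_add, ← mul_add, ← mul_add]
    by_cases h : x = 0 ∧ y = 0
    · obtain ⟨rfl, rfl⟩ := h
      simp [hφ, hF0]
    · congr 1
      exact_mod_cast zmodSawtooth_three_term (by ring) h
  rw [s1, s2, s3, t1, t2, t3, sawtoothPairing_comm F v u, sawtoothPairing_comm F w v,
    sawtoothPairing_comm F u w] at key
  simp only [Int.sign_neg, Int.cast_neg] at key
  linear_combination -key

end Pairing

section Torsion

variable {M q : ℕ} [NeZero q]

/-- A function on `ZMod q`, transported to the `q`-torsion of `ZMod M` and extended by zero. -/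
noncomputable def torsionWeight (ψ : ZMod q → ℂ) (x : ZMod M) : ℂ :=
  ∑ m : ZMod q, if ((m.val * (M / q) : ℕ) : ZMod M) = x then ψ m else 0

lemma mul_eq_zero_of_torsionWeight_ne_zero (hq : q ∣ M) {ψ : ZMod q → ℂ} {x : ZMod M}
    (hx : torsionWeight ψ x ≠ 0) : (q : ZMod M) * x = 0 := by
  obtain ⟨m, -, hm⟩ := Finset.exists_ne_zero_of_sum_ne_zero hx
  have hmx : ((m.val * (M / q) : ℕ) : ZMod M) = x := by
    by_contra h
    exact hm (if_neg h)
  rw [← hmx, ← Nat.cast_mul, show q * (m.val * (M / q)) = m.val * (q * (M / q)) by ring,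
    Nat.mul_div_cancel' hq]
  simp

lemma torsionWeight_natCast [NeZero M] (hq : q ∣ M) (ψ : ZMod q → ℂ) (j : ℕ) :
    torsionWeight ψ ((j * (M / q) : ℕ) : ZMod M) = ψ j := by
  have hr : M / q ≠ 0 := (Nat.div_pos (Nat.le_of_dvd (Nat.pos_of_ne_zero (NeZero.ne M)) hq)
    (Nat.pos_of_ne_zero (NeZero.ne q))).ne'
  have hiff : ∀ m : ZMod q, ((m.val * (M / q) : ℕ) : ZMod M) = ((j * (M / q) : ℕ) : ZMod M)
      ↔ m = j := by
    intro m
    rw [ZMod.natCast_eq_natCast_iff]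
    have h : ∀ i l : ℕ, i ≡ l [MOD M] ↔ i ≡ l [MOD q * (M / q)] := fun i l => by
      rw [Nat.mul_div_cancel' hq]
    rw [h, Nat.ModEq.mul_right_cancel_iff' hr, ← ZMod.natCast_eq_natCast_iff,
      ZMod.natCast_zmod_val]
  unfold torsionWeight
  simp only [hiff]
  simp

lemma sum_torsionWeight_mul [NeZero M] (k : ℕ) (hk : q * k ∣ M) (ψ : ZMod q → ℂ) (G : ZMod M → ℂ) :
    ∑ x : ZMod M, torsionWeight ψ ((k : ZMod M) * x) * G x
      = ∑ j ∈ Finset.range (q * k), ψ j * G ((j * (M / (q * k)) : ℕ) : ZMod M) := by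
  obtain ⟨s, hs⟩ := hk
  have hM := NeZero.ne M
  have hqk : 0 < q * k := Nat.pos_of_ne_zero fun h => hM (by simp [hs, h])
  have hs0 : 0 < s := Nat.pos_of_ne_zero fun h => hM (by simp [hs, h])
  have hdiv : M / (q * k) = s := by rw [hs, Nat.mul_div_cancel_left _ hqk]
  have hdiv' : M / q = k * s := by
    rw [hs, mul_assoc, Nat.mul_div_cancel_left _ (Nat.pos_of_ne_zero (NeZero.ne q))]
  have hq : q ∣ M := ⟨k * s, by rw [hs, mul_assoc]⟩
  rw [hdiv]
  symm
  refine Finset.sum_of_injOn (fun j : ℕ => ((j * s : ℕ) : ZMod M)) ?_ (by simp) ?_ ?_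
  · intro i hi j hj hij
    have hi := Finset.mem_range.1 hi
    have hj := Finset.mem_range.1 hj
    simp only [ZMod.natCast_eq_natCast_iff'] at hij
    rw [Nat.mod_eq_of_lt (by rw [hs]; exact Nat.mul_lt_mul_of_pos_right hi hs0),
      Nat.mod_eq_of_lt (by rw [hs]; exact Nat.mul_lt_mul_of_pos_right hj hs0)] at hij
    exact Nat.eq_of_mul_eq_mul_right hs0 hij
  · intro x _ hx
    by_contra hne
    have h0 := mul_eq_zero_of_torsionWeight_ne_zero hq (left_ne_zero_of_mul hne)
    rw [← mul_assoc, ← Nat.cast_mul, ← ZMod.natCast_zmod_val x, ← Nat.cast_mul,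
      ZMod.natCast_eq_zero_iff] at h0
    nth_rw 1 [hs] at h0
    obtain ⟨j, hj⟩ := Nat.dvd_of_mul_dvd_mul_left hqk h0
    refine hx ⟨j, ?_, ?_⟩
    · have := x.val_lt
      rw [hj] at this
      have := this.trans_eq (hs.trans (mul_comm _ _))
      simpa using Nat.lt_of_mul_lt_mul_left this
    · simp only
      rw [mul_comm, ← hj, ZMod.natCast_zmod_val]
  · intro j _
    congr 1
    rw [← torsionWeight_natCast hq ψ j, hdiv']
    congr 1
    push_cast
    ring

lemma sum_torsionWeight_add_mul [NeZero M] (a : ℤ) (ha : (q : ℤ) * a ∣ M) (ψ : ZMod q → ℂ)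
    (hψ : ∑ m, ψ m = 0) (z : ZMod M) :
    ∑ x : ZMod M, torsionWeight ψ (z + (a : ZMod M) * x) = 0 := by
  obtain ⟨t, ht⟩ := ha
  have hr : ((M / q : ℕ) : ℤ) = a * t := by
    rw [Int.natCast_div, ht, mul_assoc,
      Int.mul_ediv_cancel_left _ (by exact_mod_cast NeZero.ne q)]
  have hr' : ((M / q : ℕ) : ZMod M) = a * t := by
    exact_mod_cast congrArg (Int.cast (R := ZMod M)) hr
  unfold torsionWeight
  rw [Finset.sum_comm]
  have h1 : ∀ m : ZMod q,
      (∑ x : ZMod M, if ((m.val * (M / q) : ℕ) : ZMod M) = z + (a : ZMod M) * x then ψ m else 0)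
        = ψ m * ∑ x : ZMod M, if z + (a : ZMod M) * x = 0 then 1 else 0 := by
    intro m
    rw [Finset.mul_sum, ← Equiv.sum_comp (Equiv.addRight ((m.val : ZMod M) * t))]
    refine Finset.sum_congr rfl fun x _ => ?_
    rw [mul_ite, mul_one, mul_zero]
    refine if_congr ?_ rfl rfl
    simp only [Equiv.coe_addRight]
    push_cast
    rw [hr', eq_comm, ← sub_eq_zero]
    ring_nf
  simp only [h1]
  rw [← Finset.sum_mul, hψ, zero_mul]

end Torsion

lemma intCast_dvd_of_mul_eq_zero {M : ℕ} {e a : ℤ} (he : e ≠ 0) (h : e * a ∣ M) {x : ZMod M}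
    (hx : (e : ZMod M) * x = 0) : (a : ZMod M) ∣ x := by
  obtain ⟨i, rfl⟩ := ZMod.intCast_surjective x
  rw [← Int.cast_mul, ZMod.intCast_zmod_eq_zero_iff_dvd] at hx
  obtain ⟨j, rfl⟩ := Int.dvd_of_mul_dvd_mul_left he (h.trans hx)
  exact ⟨j, by push_cast; rfl⟩

section TorusAction

variable {M q₁ q₂ : ℕ}

/-- The action on `(ZMod M)²` of the conjugate by `diag(q₂, 1)` of the matrix
`(a b; q₁q₂c d)`. -/
def torusAction (M q₁ q₂ : ℕ) (a b c d : ℤ) (p : ZMod M × ZMod M) : ZMod M × ZMod M :=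
  (a * p.1 + b * q₂ * p.2, q₁ * c * p.1 + d * p.2)

lemma torusAction_of_torsion {a b c d : ℤ} (ha : ((q₁ * q₂ : ℕ) : ℤ) ∣ a - 1)
    (hd : ((q₁ * q₂ : ℕ) : ℤ) ∣ d - 1) {p : ZMod M × ZMod M}
    (hp : (q₁ : ZMod M) * p.1 = 0 ∧ (q₂ : ZMod M) * p.2 = 0) :
    torusAction M q₁ q₂ a b c d p = p := by
  obtain ⟨s, hs⟩ := ha
  obtain ⟨t, ht⟩ := hd
  rw [sub_eq_iff_eq_add] at hs ht
  subst hs ht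
  obtain ⟨h1, h2⟩ := hp
  ext
  · simp only [torusAction]
    push_cast
    linear_combination (q₂ * s : ZMod M) * h1 + (b : ZMod M) * h2
  · simp only [torusAction]
    push_cast
    linear_combination (c : ZMod M) * h1 + (q₁ * t : ZMod M) * h2

lemma torusAction_inverse {a b c d : ℤ} (hdet : a * d - b * ((q₁ * q₂ : ℕ) * c) = 1)
    (p : ZMod M × ZMod M) :
    torusAction M q₁ q₂ d (-b) (-c) a (torusAction M q₁ q₂ a b c d p) = p := by
  have h := congrArg (Int.cast (R := ZMod M)) hdet
  push_cast at h
  ext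
  · simp only [torusAction]
    push_cast
    linear_combination p.1 * h
  · simp only [torusAction]
    push_cast
    linear_combination p.2 * h

end TorusAction

section Newform

variable {M q₁ q₂ : ℕ} [NeZero q₁] [NeZero q₂]
  (χ₁ : DirichletCharacter ℂ q₁) (χ₂ : DirichletCharacter ℂ q₂)

/-- The weight on torsion points of the torus defining the newform Dedekind sum. -/
noncomputable def newformWeight (p : ZMod M × ZMod M) : ℂ :=
  torsionWeight (fun n => (starRingEnd ℂ) (χ₁ n)) (-p.1)
    * torsionWeight (fun n => (starRingEnd ℂ) (χ₂ n)) p.2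

lemma torsion_of_newformWeight_ne_zero (hq₁ : q₁ ∣ M) (hq₂ : q₂ ∣ M) {p : ZMod M × ZMod M}
    (hp : newformWeight χ₁ χ₂ p ≠ 0) : (q₁ : ZMod M) * p.1 = 0 ∧ (q₂ : ZMod M) * p.2 = 0 := by
  refine ⟨?_, mul_eq_zero_of_torsionWeight_ne_zero hq₂ (right_ne_zero_of_mul hp)⟩
  have := mul_eq_zero_of_torsionWeight_ne_zero hq₁ (left_ne_zero_of_mul hp)
  simpa using this

lemma newformWeight_torusAction (hq₁ : q₁ ∣ M) (hq₂ : q₂ ∣ M) {a b c d : ℤ}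
    (hdet : a * d - b * ((q₁ * q₂ : ℕ) * c) = 1) (ha : ((q₁ * q₂ : ℕ) : ℤ) ∣ a - 1)
    (hd : ((q₁ * q₂ : ℕ) : ℤ) ∣ d - 1) (p : ZMod M × ZMod M) :
    newformWeight χ₁ χ₂ (torusAction M q₁ q₂ a b c d p) = newformWeight χ₁ χ₂ p := by
  by_cases hp : newformWeight χ₁ χ₂ p = 0
  · by_contra hne
    rw [hp] at hne
    have h1 := torusAction_of_torsion (b := -b) (c := -c) hd ha
      (torsion_of_newformWeight_ne_zero χ₁ χ₂ hq₁ hq₂ hne)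
    rw [torusAction_inverse hdet] at h1
    rw [← h1] at hne
    exact hne hp
  · rw [torusAction_of_torsion ha hd (torsion_of_newformWeight_ne_zero χ₁ χ₂ hq₁ hq₂ hp)]

lemma dvd_of_newformWeight_ne_zero (hq₁ : q₁ ∣ M) (hq₂ : q₂ ∣ M) {u v : ℤ × ℤ} {a b e : ℤ}
    (he : u.1 * v.2 - u.2 * v.1 = e) (he0 : e ≠ 0) (ha : (q₁ * q₂ : ℕ) * e * a ∣ M)
    (hb : (q₁ * q₂ : ℕ) * e * b ∣ M) {x y : ZMod M}
    (hxy : newformWeight χ₁ χ₂ (x • ((u.1 : ZMod M), (u.2 : ZMod M))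
      + y • ((v.1 : ZMod M), (v.2 : ZMod M))) ≠ 0) :
    (a : ZMod M) ∣ x ∧ (b : ZMod M) ∣ y := by
  have hN : ((q₁ * q₂ : ℕ) : ℤ) ≠ 0 := by
    exact_mod_cast mul_ne_zero (NeZero.ne q₁) (NeZero.ne q₂)
  obtain ⟨h1, h2⟩ := torsion_of_newformWeight_ne_zero χ₁ χ₂ hq₁ hq₂ hxy
  simp only [Prod.fst_add, Prod.snd_add, Prod.smul_mk, smul_eq_mul] at h1 h2
  subst he
  refine ⟨intCast_dvd_of_mul_eq_zero (mul_ne_zero hN he0) ha ?_,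
    intCast_dvd_of_mul_eq_zero (mul_ne_zero hN he0) hb ?_⟩
  · push_cast
    linear_combination (q₂ * v.2 : ZMod M) * h1 - (q₁ * v.1 : ZMod M) * h2
  · push_cast
    linear_combination (q₁ * u.1 : ZMod M) * h2 - (q₂ * u.2 : ZMod M) * h1

variable [NeZero M]

lemma newformDedekindSum_eq_sawtoothPairing (h : ℤ) (k : ℕ) (hk : q₂ * k ∣ M) (hq₁ : q₁ ∣ M) :
    newformDedekindSum χ₁ χ₂ h (q₂ * k : ℕ)
      = -sawtoothPairing (M := M) (newformWeight χ₁ χ₂) (1, 0) ((h : ZMod M), (k : ZMod M)) := by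
  have hM : (M : ℝ) ≠ 0 := by exact_mod_cast NeZero.ne M
  have hinner : ∀ y : ZMod M,
      ∑ x : ZMod M, torsionWeight (fun n => (starRingEnd ℂ) (χ₁ n)) (-(x + y * (h : ZMod M)))
        * (zmodSawtooth x : ℂ)
      = -∑ n ∈ Finset.range q₁, (starRingEnd ℂ) (χ₁ (n : ZMod q₁))
          * (zmodSawtooth (((n * (M / q₁) : ℕ) : ZMod M) + y * (h : ZMod M)) : ℂ) := by
    intro y
    have := sum_torsionWeight_mul (M := M) (q := q₁) 1 (by simpa using hq₁)
      (fun n => (starRingEnd ℂ) (χ₁ n)) (fun x => (zmodSawtooth (x + y * (h : ZMod M)) : ℂ))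
    simp only [mul_one, Nat.cast_one, one_mul] at this
    rw [← this, ← Equiv.sum_comp (Equiv.subLeft (-(y * (h : ZMod M)))), ← Finset.sum_neg_distrib]
    refine Finset.sum_congr rfl fun x _ => ?_
    simp only [Equiv.subLeft_apply]
    rw [show -(-(y * (h : ZMod M)) - x + y * (h : ZMod M)) = x by ring,
      show -(y * (h : ZMod M)) - x = -(x + y * (h : ZMod M)) by ring, zmodSawtooth_neg]
    push_cast
    ring
  have hpair : sawtoothPairing (M := M) (newformWeight χ₁ χ₂) (1, 0) ((h : ZMod M), (k : ZMod M))
      = ∑ y : ZMod M, torsionWeight (fun n => (starRingEnd ℂ) (χ₂ n)) ((k : ZMod M) * y)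
        * ((zmodSawtooth y : ℂ) * ∑ x : ZMod M,
            torsionWeight (fun n => (starRingEnd ℂ) (χ₁ n)) (-(x + y * (h : ZMod M)))
              * (zmodSawtooth x : ℂ)) := by
    unfold sawtoothPairing newformWeight
    rw [Finset.sum_comm]
    refine Finset.sum_congr rfl fun y _ => ?_
    rw [Finset.mul_sum, Finset.mul_sum]
    refine Finset.sum_congr rfl fun x _ => ?_
    simp only [Prod.smul_mk, smul_eq_mul, mul_one, mul_zero, Prod.mk_add_mk, zero_add,
      mul_comm y (k : ZMod M)]
    ring
  rw [hpair]
  simp only [hinner]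
  rw [sum_torsionWeight_mul k hk, ← Finset.sum_neg_distrib]
  unfold newformDedekindSum
  rw [Int.toNat_natCast]
  refine Finset.sum_congr rfl fun j _ => ?_
  rw [mul_neg, mul_neg, neg_neg, Finset.mul_sum, Finset.mul_sum]
  refine Finset.sum_congr rfl fun n _ => ?_
  have hqk : ((q₂ * k : ℕ) : ℝ) ≠ 0 := fun h0 => NeZero.ne M (by
    have : q₂ * k = 0 := by exact_mod_cast h0
    simpa [this] using hk)
  have hq₁0 : (q₁ : ℝ) ≠ 0 := by exact_mod_cast NeZero.ne q₁
  have e1 : zmodSawtooth ((j * (M / (q₂ * k)) : ℕ) : ZMod M)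
      = sawtooth ((j : ℝ) / ((q₂ * k : ℕ) : ℤ)) := by
    rw [← Int.cast_natCast, zmodSawtooth_intCast]
    congr 1
    rw [Int.cast_natCast, Int.cast_natCast, Nat.cast_mul, Nat.cast_div hk hqk]
    field_simp
  have e2 : zmodSawtooth (((n * (M / q₁) : ℕ) : ZMod M)
        + ((j * (M / (q₂ * k)) : ℕ) : ZMod M) * (h : ZMod M))
      = sawtooth ((n : ℝ) / (q₁ : ℝ) + (h : ℝ) * (j : ℝ) / ((q₂ * k : ℕ) : ℤ)) := by
    have : (((n * (M / q₁) : ℕ) : ZMod M) + ((j * (M / (q₂ * k)) : ℕ) : ZMod M) * (h : ZMod M))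
        = (((n * (M / q₁) : ℕ) + (j * (M / (q₂ * k)) : ℕ) * h : ℤ) : ZMod M) := by
      rw [Int.cast_add, Int.cast_mul, Int.cast_natCast, Int.cast_natCast]
    rw [this, zmodSawtooth_intCast]
    congr 1
    rw [Int.cast_natCast, Int.cast_add, Int.cast_mul, Int.cast_natCast, Int.cast_natCast,
      Nat.cast_mul, Nat.cast_mul, Nat.cast_div hk hqk, Nat.cast_div hq₁ hq₁0]
    field_simp
  rw [e1, e2]
  ring

lemma newformWeight_zero (hq₂ : 1 < q₂) (hq₂M : q₂ ∣ M) :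
    newformWeight (M := M) χ₁ χ₂ 0 = 0 := by
  have : Fact (1 < q₂) := ⟨hq₂⟩
  have h := torsionWeight_natCast (M := M) hq₂M (fun n => (starRingEnd ℂ) (χ₂ n)) 0
  rw [zero_mul, Nat.cast_zero, Nat.cast_zero, MulChar.map_zero, map_zero] at h
  rw [newformWeight, Prod.snd_zero, h, mul_zero]

lemma sawtoothPairing_torusAction (hq₁ : q₁ ∣ M) (hq₂ : q₂ ∣ M) {a b c d : ℤ}
    (hdet : a * d - b * ((q₁ * q₂ : ℕ) * c) = 1) (ha : ((q₁ * q₂ : ℕ) : ℤ) ∣ a - 1)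
    (hd : ((q₁ * q₂ : ℕ) : ℤ) ∣ d - 1) (u v : ZMod M × ZMod M) :
    sawtoothPairing (newformWeight χ₁ χ₂) (torusAction M q₁ q₂ a b c d u)
        (torusAction M q₁ q₂ a b c d v)
      = sawtoothPairing (newformWeight χ₁ χ₂) u v := by
  unfold sawtoothPairing
  refine Finset.sum_congr rfl fun x _ => Finset.sum_congr rfl fun y _ => ?_
  rw [← newformWeight_torusAction χ₁ χ₂ hq₁ hq₂ hdet ha hd (x • u + y • v)]
  congr 2
  ext <;> simp [torusAction] <;> ring

lemma sum_newformWeight_line (hq₁ : q₁ ∣ M) (hq₂ : q₂ ∣ M) (hχ₁ : χ₁ ≠ 1) {a b c d : ℤ}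
    (hdet : a * d - b * ((q₁ * q₂ : ℕ) * c) = 1) (ha : ((q₁ * q₂ : ℕ) : ℤ) ∣ a - 1)
    (hd : ((q₁ * q₂ : ℕ) : ℤ) ∣ d - 1) (e : ℤ) (he : (q₁ : ℤ) * e ∣ M) (z : ZMod M × ZMod M) :
    ∑ x : ZMod M, newformWeight χ₁ χ₂
      (z + ((e : ZMod M) * x) • ((a : ZMod M), (q₁ * c : ZMod M))) = 0 := by
  have hψ : ∑ n : ZMod q₁, (starRingEnd ℂ) (χ₁ n) = 0 := by
    rw [← map_sum, MulChar.sum_eq_zero_of_ne_one hχ₁, map_zero]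
  have hdet' : d * a - -b * ((q₁ * q₂ : ℕ) * -c) = 1 := by linear_combination hdet
  have h1 : ∀ x : ZMod M, newformWeight χ₁ χ₂
      (z + ((e : ZMod M) * x) • ((a : ZMod M), (q₁ * c : ZMod M)))
      = newformWeight χ₁ χ₂ (torusAction M q₁ q₂ d (-b) (-c) a z
          + ((e : ZMod M) * x) • (1, 0)) := by
    intro x
    rw [← newformWeight_torusAction χ₁ χ₂ hq₁ hq₂ hdet' hd ha
      (z + ((e : ZMod M) * x) • ((a : ZMod M), (q₁ * c : ZMod M)))]
    have h := congrArg (Int.cast (R := ZMod M)) hdet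
    push_cast at h
    congr 1
    ext
    · simp only [torusAction, Prod.fst_add, Prod.snd_add, Prod.smul_mk, smul_eq_mul]
      push_cast
      linear_combination (e * x : ZMod M) * h
    · simp only [torusAction, Prod.fst_add, Prod.snd_add, Prod.smul_mk, smul_eq_mul]
      push_cast
      ring
  simp only [h1]
  unfold newformWeight
  simp only [Prod.fst_add, Prod.snd_add, Prod.smul_mk, smul_eq_mul, mul_zero, add_zero, mul_one]
  rw [← Finset.sum_mul, ← Equiv.sum_comp (Equiv.neg _)]
  simp only [Equiv.neg_apply, mul_neg, neg_add, neg_neg]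
  rw [sum_torsionWeight_add_mul e he _ hψ, zero_mul]

end Newform

section Gamma1

open CongruenceSubgroup

lemma exists_of_mem_Gamma1 {N : ℕ} {γ : Matrix.SpecialLinearGroup (Fin 2) ℤ}
    (hγ : γ ∈ Gamma1 N) : ∃ c : ℤ, γ 1 0 = N * c ∧
      γ 0 0 * γ 1 1 - γ 0 1 * (N * c) = 1 ∧ (N : ℤ) ∣ γ 0 0 - 1 ∧ (N : ℤ) ∣ γ 1 1 - 1 := by
  rw [Gamma1_mem] at hγ
  obtain ⟨h00, h11, h10⟩ := hγ
  obtain ⟨c, hc⟩ := (ZMod.intCast_zmod_eq_zero_iff_dvd _ _).1 h10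
  have hdet := Matrix.SpecialLinearGroup.det_coe γ
  rw [Matrix.det_fin_two] at hdet
  refine ⟨c, hc, ?_, ?_, ?_⟩
  · rw [← hc]; exact hdet
  · rw [← ZMod.intCast_zmod_eq_zero_iff_dvd]; simp [h00]
  · rw [← ZMod.intCast_zmod_eq_zero_iff_dvd]; simp [h11]

lemma eq_one_of_mem_Gamma1_of_lower_eq_zero {N : ℕ} (hN : 2 < N)
    {γ : Matrix.SpecialLinearGroup (Fin 2) ℤ} (hγ : γ ∈ Gamma1 N) (h : γ 1 0 = 0) :
    γ 0 0 = 1 ∧ γ 1 1 = 1 := by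
  obtain ⟨c, hc, hdet, ha, -⟩ := exists_of_mem_Gamma1 hγ
  rw [← hc, h, mul_zero, sub_zero] at hdet
  rcases Int.eq_one_or_neg_one_of_mul_eq_one hdet with h1 | h1
  · exact ⟨h1, by rw [h1] at hdet; linarith⟩
  · rw [h1] at ha
    have := Int.le_of_dvd (by norm_num) ((dvd_neg).2 ha)
    omega

variable {q₁ q₂ : ℕ} (χ₁ : DirichletCharacter ℂ q₁) (χ₂ : DirichletCharacter ℂ q₂)

lemma SGamma_eq_sawtoothPairing [NeZero q₁] [NeZero q₂] {M : ℕ} [NeZero M]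
    {γ : Matrix.SpecialLinearGroup (Fin 2) ℤ} {c : ℤ} (hc : γ 1 0 = (q₁ * q₂ : ℕ) * c)
    (hM : (q₁ * q₂ : ℕ) * c ∣ M) :
    SGamma χ₁ χ₂ γ = -(c.sign : ℂ) * sawtoothPairing (M := M) (newformWeight χ₁ χ₂) (1, 0)
      ((γ 0 0 : ZMod M), (q₁ * c : ZMod M)) := by
  have hN : (0 : ℤ) < (q₁ * q₂ : ℕ) := by
    exact_mod_cast Nat.pos_of_ne_zero (mul_ne_zero (NeZero.ne q₁) (NeZero.ne q₂))
  have hc0 : c ≠ 0 := by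
    rintro rfl
    exact NeZero.ne M (by simpa using hM)
  have hk : ∀ n : ℕ, c.natAbs = n → q₂ * (q₁ * n) ∣ M := by
    rintro n rfl
    have := Int.natAbs_dvd_natAbs.2 hM
    rw [Int.natAbs_mul, Int.natAbs_natCast, Int.natAbs_natCast] at this
    rwa [← mul_assoc, mul_comm q₂]
  have hq₁ : q₁ ∣ M := (Dvd.intro_left _ (by ring : q₂ * c.natAbs * q₁ = _)).trans (hk _ rfl)
  unfold SGamma
  rw [hc]
  rcases lt_or_gt_of_ne hc0 with h | h
  · have hlt : ((q₁ * q₂ : ℕ) : ℤ) * c < 0 := mul_neg_of_pos_of_neg hN h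
    obtain ⟨n, rfl⟩ : ∃ n : ℕ, c = -n := ⟨c.natAbs, by omega⟩
    rw [if_neg hlt.not_gt, if_pos hlt, Int.sign_eq_neg_one_of_neg h,
      show -(((q₁ * q₂ : ℕ) : ℤ) * -(n : ℤ)) = ((q₂ * (q₁ * n) : ℕ) : ℤ) by push_cast; ring,
      newformDedekindSum_eq_sawtoothPairing (M := M) χ₁ χ₂ _ _ (hk n (by simp)) hq₁]
    have : (((-γ 0 0 : ℤ) : ZMod M), ((q₁ * n : ℕ) : ZMod M))
        = -((γ 0 0 : ZMod M), (q₁ * ((-n : ℤ) : ZMod M) : ZMod M)) := by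
      ext <;> simp
    rw [this, sawtoothPairing_neg_right]
    push_cast
    ring
  · have hlt : 0 < ((q₁ * q₂ : ℕ) : ℤ) * c := mul_pos hN h
    obtain ⟨n, rfl⟩ : ∃ n : ℕ, c = n := ⟨c.natAbs, by omega⟩
    rw [if_pos hlt, Int.sign_eq_one_of_pos h,
      show (((q₁ * q₂ : ℕ) : ℤ) * (n : ℤ)) = ((q₂ * (q₁ * n) : ℕ) : ℤ) by push_cast; ring,
      newformDedekindSum_eq_sawtoothPairing (M := M) χ₁ χ₂ _ _ (hk n (by simp)) hq₁]
    push_cast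
    ring

lemma SGamma_eq_zero {γ : Matrix.SpecialLinearGroup (Fin 2) ℤ} (h : γ 1 0 = 0) :
    SGamma χ₁ χ₂ γ = 0 := by
  unfold SGamma
  rw [h, if_neg (lt_irrefl _), if_neg (by simp)]

lemma SGamma_congr {γ δ : Matrix.SpecialLinearGroup (Fin 2) ℤ} (h0 : γ 0 0 = δ 0 0)
    (h1 : γ 1 0 = δ 1 0) : SGamma χ₁ χ₂ γ = SGamma χ₁ χ₂ δ := by
  unfold SGamma
  rw [h0, h1]

lemma SGamma_mul (hq₁ : 1 < q₁) (hq₂ : 1 < q₂) (hχ₁ : χ₁ ≠ 1)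
    {γ δ : Matrix.SpecialLinearGroup (Fin 2) ℤ} (hγ : γ ∈ Gamma1 (q₁ * q₂))
    (hδ : δ ∈ Gamma1 (q₁ * q₂)) :
    SGamma χ₁ χ₂ (γ * δ) = SGamma χ₁ χ₂ γ + SGamma χ₁ χ₂ δ := by
  have : NeZero q₁ := ⟨by omega⟩
  have : NeZero q₂ := ⟨by omega⟩
  have hN2 : 2 < q₁ * q₂ := by nlinarith
  obtain ⟨c₁, hc₁, hdet₁, ha₁, hd₁⟩ := exists_of_mem_Gamma1 hγ
  obtain ⟨c₂, hc₂, hdet₂, ha₂, hd₂⟩ := exists_of_mem_Gamma1 hδ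
  obtain ⟨c₃, hc₃, hdet₃, ha₃, hd₃⟩ := exists_of_mem_Gamma1 (mul_mem hγ hδ)
  have hN : ((q₁ * q₂ : ℕ) : ℤ) ≠ 0 := by exact_mod_cast (by omega : q₁ * q₂ ≠ 0)
  have e0 : (γ * δ) 0 0 = γ 0 0 * δ 0 0 + γ 0 1 * δ 1 0 := by
    rw [Matrix.SpecialLinearGroup.coe_mul, Matrix.mul_apply, Fin.sum_univ_two]
  have e1 : (γ * δ) 1 0 = γ 1 0 * δ 0 0 + γ 1 1 * δ 1 0 := by
    rw [Matrix.SpecialLinearGroup.coe_mul, Matrix.mul_apply, Fin.sum_univ_two]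
  have ec₃ : c₃ = c₁ * δ 0 0 + γ 1 1 * c₂ := by
    rw [hc₁, hc₂, hc₃] at e1
    refine mul_left_cancel₀ hN ?_
    linear_combination e1
  have hact : ∀ M : ℕ, (((γ * δ) 0 0 : ZMod M), (q₁ * c₃ : ZMod M))
      = torusAction M q₁ q₂ (γ 0 0) (γ 0 1) c₁ (γ 1 1) ((δ 0 0 : ZMod M), (q₁ * c₂ : ZMod M)) := by
    intro M
    rw [e0, ec₃, hc₂]
    ext <;> simp only [torusAction] <;> push_cast <;> ring
  have hact1 : ∀ M : ℕ, ((γ 0 0 : ZMod M), (q₁ * c₁ : ZMod M))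
      = torusAction M q₁ q₂ (γ 0 0) (γ 0 1) c₁ (γ 1 1) (1, 0) := by
    intro M
    ext <;> simp [torusAction]
  by_cases h1 : c₁ = 0
  · have h10 : γ 1 0 = 0 := by rw [hc₁, h1, mul_zero]
    obtain ⟨-, hd⟩ := eq_one_of_mem_Gamma1_of_lower_eq_zero hN2 hγ h10
    have h32 : c₃ = c₂ := by rw [ec₃, h1, hd]; ring
    rw [SGamma_eq_zero χ₁ χ₂ h10, zero_add]
    by_cases h2 : c₂ = 0
    · rw [SGamma_eq_zero χ₁ χ₂ (hc₂.trans (by rw [h2, mul_zero])),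
        SGamma_eq_zero χ₁ χ₂ (hc₃.trans (by rw [h32, h2, mul_zero]))]
    · set M := (((q₁ * q₂ : ℕ) : ℤ) * c₂).natAbs
      have : NeZero M := ⟨Int.natAbs_ne_zero.2 (mul_ne_zero hN h2)⟩
      have hM : ((q₁ * q₂ : ℕ) : ℤ) * c₂ ∣ M := Int.dvd_natAbs_self
      have hNM : q₁ * q₂ ∣ M := by
        exact_mod_cast (Dvd.intro _ rfl : ((q₁ * q₂ : ℕ) : ℤ) ∣ _).trans hM
      have hSδ := SGamma_eq_sawtoothPairing χ₁ χ₂ hc₂ hM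
      rw [← sawtoothPairing_torusAction χ₁ χ₂ ((Dvd.intro _ rfl).trans hNM)
        ((Dvd.intro_left _ rfl).trans hNM) hdet₁ ha₁ hd₁ (1, 0), ← hact1, ← hact] at hSδ
      rw [SGamma_eq_sawtoothPairing χ₁ χ₂ hc₃ (by rw [h32]; exact hM), hSδ, h32, h1,
        (eq_one_of_mem_Gamma1_of_lower_eq_zero hN2 hγ h10).1]
      simp
  by_cases h2 : c₂ = 0
  · have h20 : δ 1 0 = 0 := by rw [hc₂, h2, mul_zero]
    obtain ⟨ha, -⟩ := eq_one_of_mem_Gamma1_of_lower_eq_zero hN2 hδ h20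
    rw [SGamma_eq_zero χ₁ χ₂ h20, add_zero]
    exact SGamma_congr χ₁ χ₂ (by rw [e0, ha, h20]; ring) (by rw [e1, ha, h20]; ring)
  set C : ℤ := if c₃ = 0 then 1 else c₃ with hC
  have hC0 : C ≠ 0 := by
    rw [hC]; split_ifs with h
    · exact one_ne_zero
    · exact h
  set M := (((q₁ * q₂ : ℕ) : ℤ) * (q₁ * c₁) * (q₁ * c₂) * (q₁ * C)).natAbs
  have hq₁0 : (q₁ : ℤ) ≠ 0 := by exact_mod_cast NeZero.ne q₁
  have : NeZero M := ⟨Int.natAbs_ne_zero.2 (mul_ne_zero (mul_ne_zero (mul_ne_zero hN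
    (mul_ne_zero hq₁0 h1)) (mul_ne_zero hq₁0 h2)) (mul_ne_zero hq₁0 hC0))⟩
  have hdvd : ∀ x y : ℤ, x * y = ((q₁ * q₂ : ℕ) : ℤ) * (q₁ * c₁) * (q₁ * c₂) * (q₁ * C) →
      x ∣ (M : ℤ) := fun x y h => Int.dvd_natAbs.2 ⟨y, h.symm⟩
  have hNM : q₁ * q₂ ∣ M := by
    exact_mod_cast hdvd (q₁ * q₂ : ℕ) ((q₁ * c₁) * (q₁ * c₂) * (q₁ * C)) (by ring)
  have hq₁M : q₁ ∣ M := (Dvd.intro _ rfl).trans hNM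
  have hq₂M : q₂ ∣ M := (Dvd.intro_left _ rfl).trans hNM
  have hSγ := SGamma_eq_sawtoothPairing χ₁ χ₂ (M := M) hc₁
    (hdvd _ (q₁ * (q₁ * c₂) * (q₁ * C)) (by ring))
  have hSδ := SGamma_eq_sawtoothPairing χ₁ χ₂ (M := M) hc₂
    (hdvd _ (q₁ * (q₁ * c₁) * (q₁ * C)) (by ring))
  rw [← sawtoothPairing_torusAction χ₁ χ₂ hq₁M hq₂M hdet₁ ha₁ hd₁ (1, 0), ← hact1, ← hact] at hSδ
  by_cases h3 : c₃ = 0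
  · have h30 : (γ * δ) 1 0 = 0 := by rw [hc₃, h3, mul_zero]
    obtain ⟨ha, -⟩ := eq_one_of_mem_Gamma1_of_lower_eq_zero hN2 (mul_mem hγ hδ) h30
    have h21 : c₂ = -c₁ := by
      have hb : γ 0 0 * δ 0 0 + γ 0 1 * ((q₁ * q₂ : ℕ) * c₂) = 1 := by rw [← hc₂, ← e0, ha]
      have hc : c₁ * δ 0 0 + γ 1 1 * c₂ = 0 := by rw [← ec₃, h3]
      linear_combination (-c₂) * hdet₁ + γ 0 0 * hc - c₁ * hb
    rw [SGamma_eq_zero χ₁ χ₂ h30, hSγ, hSδ, ha, h3, sawtoothPairing_comm, h21]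
    simp
  have hC3 : C = c₃ := if_neg h3
  rw [hC3] at hdvd
  have hSγδ := SGamma_eq_sawtoothPairing χ₁ χ₂ (M := M) hc₃
    (hdvd _ (q₁ * (q₁ * c₁) * (q₁ * c₂)) (by ring))
  have ec₂ : γ 0 0 * c₃ - c₁ * (γ * δ) 0 0 = c₂ := by
    rw [e0, ec₃, hc₂]
    linear_combination c₂ * hdet₁
  have hsupp : ∀ (u v : ℤ × ℤ) (a b e : ℤ), u.1 * v.2 - u.2 * v.1 = e → e ≠ 0 →
      (∃ t, e * a * b * t = (q₁ * c₁) * (q₁ * c₂) * (q₁ * c₃)) →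
      ∀ x y : ZMod M, newformWeight χ₁ χ₂ (x • ((u.1 : ZMod M), (u.2 : ZMod M))
        + y • ((v.1 : ZMod M), (v.2 : ZMod M))) ≠ 0 → (a : ZMod M) ∣ x ∧ (b : ZMod M) ∣ y := by
    intro u v a b e he he0 ⟨t, ht⟩ x y hxy
    exact dvd_of_newformWeight_ne_zero χ₁ χ₂ hq₁M hq₂M he he0
      (hdvd _ (b * t) (by linear_combination ((q₁ * q₂ : ℕ) : ℤ) * ht))
      (hdvd _ (a * t) (by linear_combination ((q₁ * q₂ : ℕ) : ℤ) * ht)) hxy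
  have huv := hsupp (1, 0) (γ 0 0, q₁ * c₁) (q₁ * c₂) (-(q₁ * c₃)) (q₁ * c₁) (by ring)
    (mul_ne_zero hq₁0 h1) ⟨-1, by ring⟩
  have hvw := hsupp (γ 0 0, q₁ * c₁) ((γ * δ) 0 0, q₁ * c₃) (-(q₁ * c₃)) (q₁ * c₁) (q₁ * c₂)
    (by linear_combination (q₁ : ℤ) * ec₂) (mul_ne_zero hq₁0 h2) ⟨-1, by ring⟩
  have hwu := hsupp ((γ * δ) 0 0, q₁ * c₃) (1, 0) (q₁ * c₁) (q₁ * c₂) (-(q₁ * c₃)) (by ring)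
    (neg_ne_zero.2 (mul_ne_zero hq₁0 h3)) ⟨-1, by ring⟩
  have hu := sum_newformWeight_line (M := M) χ₁ χ₂ hq₁M hq₂M hχ₁ (a := 1) (b := 0) (c := 0)
    (d := 1) (by ring) (by simp) (by simp) (q₁ * c₂)
    (hdvd _ (q₂ * (q₁ * c₁) * (q₁ * c₃)) (by push_cast; ring))
  have hv := sum_newformWeight_line (M := M) χ₁ χ₂ hq₁M hq₂M hχ₁ hdet₁ ha₁ hd₁ (-(q₁ * c₃))
    (hdvd _ (-(q₂ * (q₁ * c₁) * (q₁ * c₂))) (by push_cast; ring))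
  have hw := sum_newformWeight_line (M := M) χ₁ χ₂ hq₁M hq₂M hχ₁ hdet₃ ha₃ hd₃ (q₁ * c₁)
    (hdvd _ (q₂ * (q₁ * c₂) * (q₁ * c₃)) (by push_cast; ring))
  have hrel : (((q₁ * c₂ : ℤ) : ZMod M)) • ((1 : ZMod M), (0 : ZMod M))
      + ((-(q₁ * c₃) : ℤ) : ZMod M) • ((γ 0 0 : ZMod M), (q₁ * c₁ : ZMod M))
      + ((q₁ * c₁ : ℤ) : ZMod M) • (((γ * δ) 0 0 : ZMod M), (q₁ * c₃ : ZMod M)) = 0 := by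
    have h := congrArg (Int.cast (R := ZMod M)) ec₂
    push_cast at h
    ext
    · simp only [Prod.fst_add, Prod.smul_mk, smul_eq_mul, Prod.fst_zero]
      push_cast
      linear_combination -(q₁ : ZMod M) * h
    · simp only [Prod.snd_add, Prod.smul_mk, smul_eq_mul, Prod.snd_zero]
      push_cast
      ring
  simp only [Int.cast_mul, Int.cast_natCast, Int.cast_one, Int.cast_zero, mul_zero]
    at huv hvw hwu hu hv hw hrel
  have key := sawtoothPairing_three_term (newformWeight χ₁ χ₂)
    (a := q₁ * c₂) (b := -(q₁ * c₃)) (c := q₁ * c₁)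
    (u := (1, 0)) (v := ((γ 0 0 : ZMod M), (q₁ * c₁ : ZMod M)))
    (w := (((γ * δ) 0 0 : ZMod M), (q₁ * c₃ : ZMod M)))
    (hdvd _ ((q₁ * q₂ : ℕ) * (q₁ * c₁) * (q₁ * c₃)) (by ring))
    (hdvd _ (-((q₁ * q₂ : ℕ) * (q₁ * c₁) * (q₁ * c₂))) (by ring))
    (hdvd _ ((q₁ * q₂ : ℕ) * (q₁ * c₂) * (q₁ * c₃)) (by ring))
    (by simpa using hrel) (newformWeight_zero χ₁ χ₂ hq₂ hq₂M)
    (by simpa using huv) (by simpa using hvw) (by simpa using hwu)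
    (by simpa using hu) (by simpa using hv) (by simpa using hw)
  rw [hSγδ, hSγ, hSδ, sawtoothPairing_comm _ (1, 0) (((γ * δ) 0 0 : ZMod M), (q₁ * c₃ : ZMod M))]
  have hsq : ∀ c : ℤ, c ≠ 0 → (c.sign : ℂ) * c.sign = 1 := fun c hc => by
    rcases lt_or_gt_of_ne hc with h | h
    · simp [Int.sign_eq_neg_one_of_neg h]
    · simp [Int.sign_eq_one_of_pos h]
  have hsq₁ : (q₁ : ℤ).sign = 1 := Int.sign_eq_one_of_pos (by omega)
  simp only [Int.sign_neg, Int.sign_mul, hsq₁, one_mul, Int.cast_neg] at key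
  have k1 := hsq c₁ h1
  have k2 := hsq c₂ h2
  have k3 := hsq c₃ h3
  generalize (c₁.sign : ℂ) = s₁ at *
  generalize (c₂.sign : ℂ) = s₂ at *
  generalize (c₃.sign : ℂ) = s₃ at *
  generalize sawtoothPairing (M := M) (newformWeight χ₁ χ₂) (1, 0) _ = P₁ at *
  generalize sawtoothPairing (M := M) (newformWeight χ₁ χ₂) _ (1, 0) = P₃ at *
  generalize sawtoothPairing (M := M) (newformWeight χ₁ χ₂) _ _ = P₂ at *
  have e1 : s₁ * s₁ * (s₂ * s₂) * s₃ * P₃ = s₃ * P₃ := by rw [k1, k2]; ring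
  have e2 : s₂ * s₂ * (s₃ * s₃) * s₁ * P₁ = s₁ * P₁ := by rw [k2, k3]; ring
  have e3 : s₁ * s₁ * (s₃ * s₃) * s₂ * P₂ = s₂ * P₂ := by rw [k1, k3]; ring
  linear_combination (-(s₁ * s₂ * s₃)) * key + e1 - e2 - e3

end Gamma1

/-- The image `S_{χ₁,χ₂}(Γ₁(q₁q₂))` is an additive subgroup of `ℂ` which is a finitely
generated free abelian group (a free `ℤ`-module of finite rank). -/
theorem image_Gamma1_free_abelian {q₁ q₂ : ℕ} (hq₁ : 1 < q₁) (hq₂ : 1 < q₂)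
    (χ₁ : DirichletCharacter ℂ q₁) (χ₂ : DirichletCharacter ℂ q₂)
    (hχ₁ : DirichletCharacter.IsPrimitive χ₁) (hχ₂ : DirichletCharacter.IsPrimitive χ₂)
    (hpar : χ₁ (-1) * χ₂ (-1) = 1) :
    ∃ H : AddSubgroup ℂ,
      (H : Set ℂ) = SGamma χ₁ χ₂ ''
          (CongruenceSubgroup.Gamma1 (q₁ * q₂) : Set (Matrix.SpecialLinearGroup (Fin 2) ℤ)) ∧
      Module.Free ℤ H ∧ Module.Finite ℤ H := by
  have : NeZero q₁ := ⟨by omega⟩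
  have : NeZero (q₁ * q₂) := ⟨by positivity⟩
  have hne : χ₁ ≠ 1 := by
    rintro rfl
    rw [DirichletCharacter.isPrimitive_def, DirichletCharacter.conductor_one] at hχ₁
    omega
  have hfg : Group.FG (Matrix.SpecialLinearGroup (Fin 2) ℤ) :=
    Group.fg_iff.2 ⟨_, SpecialLinearGroup.SL2Z_generators, by simp⟩
  have hfg' : Group.FG (CongruenceSubgroup.Gamma1 (q₁ * q₂)) := Subgroup.fg_of_index_ne_zero _
  let f : Additive (CongruenceSubgroup.Gamma1 (q₁ * q₂)) →+ ℂ :=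
    AddMonoidHom.mk' (fun γ => SGamma χ₁ χ₂ γ.toMul.1) fun γ δ =>
      SGamma_mul χ₁ χ₂ hq₁ hq₂ hne γ.toMul.2 δ.toMul.2
  have hfin : Module.Finite ℤ f.range := Module.Finite.iff_addGroup_fg.2 inferInstance
  refine ⟨f.range, ?_, inferInstance, hfin⟩
  ext z
  constructor
  · rintro ⟨γ, rfl⟩
    exact ⟨_, γ.toMul.2, rfl⟩
  · rintro ⟨γ, hγ, rfl⟩
    exact ⟨Additive.ofMul ⟨γ, hγ⟩, rfl⟩
end

section
/- Let φ : Γ₁(N) → ℂ be a group homomorphism into (ℂ, +). Then π_ψ(φ) satisfies the ψ-crossed homomorphism property: for all γ₁, γ₂ ∈ Γ₀(N), π_ψ(φ)(γ₁γ₂) = π_ψ(φ)(γ₁) + ψ(d(γ₁))·π_ψ(φ)(γ₂). -/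
open scoped BigOperators

/-- The lower-right entry of a matrix in `SL(2, ℤ)`, reduced modulo `N`. -/
def dmap (N : ℕ) (γ : Matrix.SpecialLinearGroup (Fin 2) ℤ) : ZMod N :=
  (((γ : Matrix (Fin 2) (Fin 2) ℤ) 1 1 : ℤ) : ZMod N)

/-- A section `β : (ℤ/Nℤ)ˣ → Γ₀(N)` extended to all of `ℤ/Nℤ` (by `1` at non-units). -/
noncomputable def betaExt (N : ℕ) (β : (ZMod N)ˣ → Matrix.SpecialLinearGroup (Fin 2) ℤ)
    (x : ZMod N) : Matrix.SpecialLinearGroup (Fin 2) ℤ :=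
  open scoped Classical in
  if h : IsUnit x then β h.unit else 1

/-- The projection `π_ψ`:
`π_ψ(φ)(γ) = (1/φ(N)) Σ_{j ∈ (ℤ/Nℤ)ˣ} ψ̄(j) φ(β(j) γ β(j·d(γ))⁻¹)`. -/
noncomputable def projPsi (N : ℕ) [NeZero N] (ψ : DirichletCharacter ℂ N)
    (β : (ZMod N)ˣ → Matrix.SpecialLinearGroup (Fin 2) ℤ)
    (φ : Matrix.SpecialLinearGroup (Fin 2) ℤ → ℂ)
    (γ : Matrix.SpecialLinearGroup (Fin 2) ℤ) : ℂ :=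
  (N.totient : ℂ)⁻¹ * ∑ j : (ZMod N)ˣ,
    (starRingEnd ℂ) (ψ (j : ZMod N)) *
      φ (β j * γ * (betaExt N β ((j : ZMod N) * dmap N γ))⁻¹)

open CongruenceSubgroup in
/-- The lower-right entry modulo `N` as a group homomorphism `Γ₀(N) → (ℤ/Nℤ)ˣ`. -/
noncomputable def gamma0UnitsHom (N : ℕ) : Gamma0 N →* (ZMod N)ˣ :=
  (Gamma0Map N).toHomUnits

theorem gamma0UnitsHom_coe (N : ℕ) (γ : CongruenceSubgroup.Gamma0 N) :
    (gamma0UnitsHom N γ : ZMod N) = dmap N γ :=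
  rfl

theorem mem_Gamma1_of_gamma0UnitsHom_eq_one {N : ℕ} {γ : CongruenceSubgroup.Gamma0 N}
    (h : gamma0UnitsHom N γ = 1) :
    (γ : Matrix.SpecialLinearGroup (Fin 2) ℤ) ∈ CongruenceSubgroup.Gamma1 N := by
  rw [CongruenceSubgroup.Gamma1_mem, ← CongruenceSubgroup.Gamma1_to_Gamma0_mem,
    CongruenceSubgroup.Gamma1_mem']
  exact congrArg Units.val h

theorem betaExt_coe (N : ℕ) (β : (ZMod N)ˣ → Matrix.SpecialLinearGroup (Fin 2) ℤ)
    (u : (ZMod N)ˣ) : betaExt N β (u : ZMod N) = β u := by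
  simp [betaExt]

theorem projPsi_apply_coe (N : ℕ) [NeZero N] (ψ : DirichletCharacter ℂ N)
    (β : (ZMod N)ˣ → Matrix.SpecialLinearGroup (Fin 2) ℤ)
    (φ : Matrix.SpecialLinearGroup (Fin 2) ℤ → ℂ) (γ : CongruenceSubgroup.Gamma0 N) :
    projPsi N ψ β φ γ = (N.totient : ℂ)⁻¹ * ∑ j : (ZMod N)ˣ,
      (starRingEnd ℂ) (ψ j) * φ (β j * γ * (β (j * gamma0UnitsHom N γ))⁻¹) := by
  simp only [projPsi, ← gamma0UnitsHom_coe, ← Units.val_mul, betaExt_coe]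

theorem beta_mul_mul_inv_mem_Gamma1 {N : ℕ}
    {β : (ZMod N)ˣ → Matrix.SpecialLinearGroup (Fin 2) ℤ}
    (hβ0 : ∀ j, β j ∈ CongruenceSubgroup.Gamma0 N)
    (hβd : ∀ j, dmap N (β j) = (j : ZMod N))
    (γ : CongruenceSubgroup.Gamma0 N) (j : (ZMod N)ˣ) :
    β j * γ * (β (j * gamma0UnitsHom N γ))⁻¹ ∈ CongruenceSubgroup.Gamma1 N := by
  have hβ (k : (ZMod N)ˣ) : gamma0UnitsHom N ⟨β k, hβ0 k⟩ = k := Units.ext (hβd k)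
  refine mem_Gamma1_of_gamma0UnitsHom_eq_one
    (γ := ⟨β j, hβ0 j⟩ * γ * (⟨β (j * gamma0UnitsHom N γ), hβ0 _⟩)⁻¹) ?_
  rw [map_mul, map_mul, map_inv, hβ, hβ, mul_inv_cancel]

theorem DirichletCharacter.conj_eq_mul_conj_mul {N : ℕ} [NeZero N]
    (ψ : DirichletCharacter ℂ N) (j u : (ZMod N)ˣ) :
    (starRingEnd ℂ) (ψ j) = ψ u * (starRingEnd ℂ) (ψ ↑(j * u)) := by
  have h : ψ u * (starRingEnd ℂ) (ψ u) = 1 := by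
    rw [Complex.mul_conj', ψ.unit_norm_eq_one]
    norm_num
  rw [Units.val_mul, map_mul, map_mul, mul_left_comm, h, mul_one]

/-- If `φ : Γ₁(N) → (ℂ, +)` is a group homomorphism, then `π_ψ(φ)` satisfies the
`ψ`-crossed homomorphism property on `Γ₀(N)`. -/
theorem projPsi_crossed_hom (N : ℕ) [NeZero N] (ψ : DirichletCharacter ℂ N)
    (β : (ZMod N)ˣ → Matrix.SpecialLinearGroup (Fin 2) ℤ)
    (hβ0 : ∀ j, β j ∈ CongruenceSubgroup.Gamma0 N)
    (hβd : ∀ j, dmap N (β j) = (j : ZMod N))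
    (φ : Matrix.SpecialLinearGroup (Fin 2) ℤ → ℂ)
    (hφ : ∀ x ∈ CongruenceSubgroup.Gamma1 N, ∀ y ∈ CongruenceSubgroup.Gamma1 N,
      φ (x * y) = φ x + φ y) :
    ∀ γ₁ ∈ CongruenceSubgroup.Gamma0 N, ∀ γ₂ ∈ CongruenceSubgroup.Gamma0 N,
      projPsi N ψ β φ (γ₁ * γ₂) =
        projPsi N ψ β φ γ₁ + ψ (dmap N γ₁) * projPsi N ψ β φ γ₂ := by
  intro γ₁ h₁ γ₂ h₂
  lift γ₁ to CongruenceSubgroup.Gamma0 N using h₁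
  lift γ₂ to CongruenceSubgroup.Gamma0 N using h₂
  have hmem := beta_mul_mul_inv_mem_Gamma1 hβ0 hβd
  have hsplit (j : (ZMod N)ˣ) :
      φ (β j * ↑(γ₁ * γ₂) * (β (j * gamma0UnitsHom N (γ₁ * γ₂)))⁻¹) =
        φ (β j * γ₁ * (β (j * gamma0UnitsHom N γ₁))⁻¹) +
          φ (β (j * gamma0UnitsHom N γ₁) * γ₂ *
            (β (j * gamma0UnitsHom N γ₁ * gamma0UnitsHom N γ₂))⁻¹) := by
    rw [← hφ _ (hmem γ₁ j) _ (hmem γ₂ (j * gamma0UnitsHom N γ₁)), map_mul, ← mul_assoc j,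
      Subgroup.coe_mul]
    congr 1
    group
  have hshift : ∑ j : (ZMod N)ˣ, (starRingEnd ℂ) (ψ j) *
        φ (β (j * gamma0UnitsHom N γ₁) * γ₂ *
          (β (j * gamma0UnitsHom N γ₁ * gamma0UnitsHom N γ₂))⁻¹) =
      ψ (gamma0UnitsHom N γ₁) * ∑ j : (ZMod N)ˣ, (starRingEnd ℂ) (ψ j) *
        φ (β j * γ₂ * (β (j * gamma0UnitsHom N γ₂))⁻¹) := by
    rw [Finset.mul_sum]
    refine Fintype.sum_equiv (Equiv.mulRight (gamma0UnitsHom N γ₁)) _ _ fun j => ?_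
    rw [ψ.conj_eq_mul_conj_mul j (gamma0UnitsHom N γ₁), mul_assoc, Equiv.coe_mulRight]
  rw [← Subgroup.coe_mul, ← gamma0UnitsHom_coe]
  simp only [projPsi_apply_coe, hsplit, mul_add, Finset.sum_add_distrib, hshift]
  ring
end

section
/- Let χ and ψ be Dirichlet characters modulo N, and let f : Γ₀(N) → ℂ satisfy the χ-crossed homomorphism property f(γ₁γ₂) = f(γ₁) + χ(d(γ₁))·f(γ₂) for all γ₁, γ₂ ∈ Γ₀(N). Define π_ψ(f) : Γ₀(N) → ℂ by π_ψ(f)(γ) = (1/φ(N)) Σ_{j ∈ (ℤ/Nℤ)^×} ψ̄(j)·f(β(j)·γ·β(j·d(γ))⁻¹). Then: if ψ ≠ χ, there exists m ∈ ℂ such that π_ψ(f)(γ) = ψ(d(γ))·m − m for all γ ∈ Γ₀(N) (i.e., π_ψ(f) is a principal crossed homomorphism); and if ψ = χ, there exists m ∈ ℂ such that π_ψ(f)(γ) = f(γ) + ψ(d(γ))·m − m for all γ ∈ Γ₀(N). -/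
open scoped BigOperators

theorem dmap_mul {N : ℕ} {γ₁ γ₂ : Matrix.SpecialLinearGroup (Fin 2) ℤ}
    (h₁ : γ₁ ∈ CongruenceSubgroup.Gamma0 N) :
    dmap N (γ₁ * γ₂) = dmap N γ₁ * dmap N γ₂ := by
  rw [CongruenceSubgroup.Gamma0_mem] at h₁
  simp [dmap, Matrix.mul_apply, Fin.sum_univ_two, h₁]

theorem isUnit_dmap {N : ℕ} {γ : Matrix.SpecialLinearGroup (Fin 2) ℤ}
    (h : γ ∈ CongruenceSubgroup.Gamma0 N) : IsUnit (dmap N γ) := by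
  refine .of_mul_eq_one (dmap N γ⁻¹) ?_
  rw [← dmap_mul h, mul_inv_cancel]
  simp [dmap]

theorem crossedHom_section_conj {N : ℕ} {χ : DirichletCharacter ℂ N}
    {β : (ZMod N)ˣ → Matrix.SpecialLinearGroup (Fin 2) ℤ}
    (hβ0 : ∀ j, β j ∈ CongruenceSubgroup.Gamma0 N)
    (hβd : ∀ j, dmap N (β j) = (j : ZMod N))
    {f : Matrix.SpecialLinearGroup (Fin 2) ℤ → ℂ}
    (hf : ∀ γ₁ ∈ CongruenceSubgroup.Gamma0 N, ∀ γ₂ ∈ CongruenceSubgroup.Gamma0 N,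
      f (γ₁ * γ₂) = f γ₁ + χ (dmap N γ₁) * f γ₂)
    {γ : Matrix.SpecialLinearGroup (Fin 2) ℤ} (hγ : γ ∈ CongruenceSubgroup.Gamma0 N)
    {u : (ZMod N)ˣ} (hu : (u : ZMod N) = dmap N γ) (j : (ZMod N)ˣ) :
    f (β j * γ * (β (j * u))⁻¹) = f (β j) + χ j * f γ - f (β (j * u)) := by
  set g := β j * γ * (β (j * u))⁻¹ with hg
  have hg0 : g ∈ CongruenceSubgroup.Gamma0 N :=
    mul_mem (mul_mem (hβ0 j) hγ) (inv_mem (hβ0 _))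
  have hmul : g * β (j * u) = β j * γ := by simp [hg]
  have hd : dmap N g = 1 := by
    have h := congrArg (dmap N) hmul
    rw [dmap_mul hg0, dmap_mul (hβ0 j), hβd, hβd, ← hu, ← Units.val_mul] at h
    exact (j * u).isUnit.mul_eq_right.mp h
  have h := congrArg f hmul
  rw [hf _ hg0 _ (hβ0 _), hf _ (hβ0 j) _ hγ, hd, hβd, map_one, one_mul] at h
  linear_combination h

theorem conj_mul_self_of_unit {N : ℕ} [NeZero N] (ψ : DirichletCharacter ℂ N) (u : (ZMod N)ˣ) :
    (starRingEnd ℂ) (ψ u) * ψ u = 1 := by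
  rw [Complex.conj_mul', ψ.unit_norm_eq_one u]
  simp

theorem sum_units_conj_mul (N : ℕ) [NeZero N] (χ ψ : DirichletCharacter ℂ N) :
    ∑ j : (ZMod N)ˣ, (starRingEnd ℂ) (ψ j) * χ j = if ψ = χ then (N.totient : ℂ) else 0 := by
  split_ifs with h
  · subst h
    simp [conj_mul_self_of_unit, ZMod.card_units_eq_totient]
  · obtain ⟨u, hu⟩ : ∃ u : (ZMod N)ˣ, (starRingEnd ℂ) (ψ u) * χ u ≠ 1 := by
      by_contra! H
      refine h (MulChar.ext fun u => ?_)
      linear_combination χ u * conj_mul_self_of_unit ψ u - ψ u * H u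
    have key : (starRingEnd ℂ) (ψ u) * χ u * ∑ j : (ZMod N)ˣ, (starRingEnd ℂ) (ψ j) * χ j =
        ∑ j : (ZMod N)ˣ, (starRingEnd ℂ) (ψ j) * χ j := by
      rw [Finset.mul_sum]
      refine Fintype.sum_equiv (Equiv.mulLeft u) _ _ fun j => ?_
      simp only [Equiv.coe_mulLeft, Units.val_mul, map_mul]
      ring
    by_contra h0
    exact hu ((mul_eq_right₀ h0).mp key)

theorem projPsi_crossedHom (N : ℕ) [NeZero N] (χ ψ : DirichletCharacter ℂ N)
    {β : (ZMod N)ˣ → Matrix.SpecialLinearGroup (Fin 2) ℤ}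
    (hβ0 : ∀ j, β j ∈ CongruenceSubgroup.Gamma0 N)
    (hβd : ∀ j, dmap N (β j) = (j : ZMod N))
    {f : Matrix.SpecialLinearGroup (Fin 2) ℤ → ℂ}
    (hf : ∀ γ₁ ∈ CongruenceSubgroup.Gamma0 N, ∀ γ₂ ∈ CongruenceSubgroup.Gamma0 N,
      f (γ₁ * γ₂) = f γ₁ + χ (dmap N γ₁) * f γ₂)
    {γ : Matrix.SpecialLinearGroup (Fin 2) ℤ} (hγ : γ ∈ CongruenceSubgroup.Gamma0 N) :
    projPsi N ψ β f γ = (N.totient : ℂ)⁻¹ *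
      ((if ψ = χ then (N.totient : ℂ) else 0) * f γ +
        (1 - ψ (dmap N γ)) * ∑ j : (ZMod N)ˣ, (starRingEnd ℂ) (ψ j) * f (β j)) := by
  obtain ⟨u, hu⟩ := isUnit_dmap hγ
  have hshift : ∑ j : (ZMod N)ˣ, (starRingEnd ℂ) (ψ j) * f (β (j * u)) =
      ψ u * ∑ j : (ZMod N)ˣ, (starRingEnd ℂ) (ψ j) * f (β j) := by
    rw [Finset.mul_sum]
    refine Fintype.sum_equiv (Equiv.mulRight u) _ _ fun j => ?_
    simp only [Equiv.coe_mulRight, Units.val_mul, map_mul]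
    linear_combination
      -((starRingEnd ℂ) (ψ j) * f (β (j * u))) * conj_mul_self_of_unit ψ u
  rw [projPsi, ← sum_units_conj_mul, sub_mul, one_mul, ← hu, ← hshift, Finset.sum_mul,
    ← Finset.sum_sub_distrib, ← Finset.sum_add_distrib]
  congr 1
  refine Finset.sum_congr rfl fun j _ => ?_
  rw [← Units.val_mul, betaExt_coe, crossedHom_section_conj hβ0 hβd hf hγ hu]
  ring

/-- If `f : Γ₀(N) → ℂ` is a `χ`-crossed homomorphism, then `π_ψ(f)` is a principal
`ψ`-crossed homomorphism when `ψ ≠ χ`, and differs from `f` by a principal crossed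
homomorphism when `ψ = χ`. -/
theorem projPsi_on_crossed_hom (N : ℕ) [NeZero N] (χ ψ : DirichletCharacter ℂ N)
    (β : (ZMod N)ˣ → Matrix.SpecialLinearGroup (Fin 2) ℤ)
    (hβ0 : ∀ j, β j ∈ CongruenceSubgroup.Gamma0 N)
    (hβd : ∀ j, dmap N (β j) = (j : ZMod N))
    (f : Matrix.SpecialLinearGroup (Fin 2) ℤ → ℂ)
    (hf : ∀ γ₁ ∈ CongruenceSubgroup.Gamma0 N, ∀ γ₂ ∈ CongruenceSubgroup.Gamma0 N,
      f (γ₁ * γ₂) = f γ₁ + χ (dmap N γ₁) * f γ₂) :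
    (ψ ≠ χ → ∃ m : ℂ, ∀ γ ∈ CongruenceSubgroup.Gamma0 N,
      projPsi N ψ β f γ = ψ (dmap N γ) * m - m) ∧
    (ψ = χ → ∃ m : ℂ, ∀ γ ∈ CongruenceSubgroup.Gamma0 N,
      projPsi N ψ β f γ = f γ + ψ (dmap N γ) * m - m) := by
  have hφ : (N.totient : ℂ) ≠ 0 :=
    Nat.cast_ne_zero.mpr (Nat.totient_pos.mpr (NeZero.pos N)).ne'
  constructor <;> intro h <;>
    refine ⟨-((N.totient : ℂ)⁻¹ * ∑ j : (ZMod N)ˣ, (starRingEnd ℂ) (ψ j) * f (β j)),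
      fun γ hγ => ?_⟩
  · rw [projPsi_crossedHom N χ ψ hβ0 hβd hf hγ, if_neg h]
    ring
  · rw [projPsi_crossedHom N χ ψ hβ0 hβd hf hγ, if_pos h, mul_add, inv_mul_cancel_left₀ hφ]
    ring
end

section
/- Every group homomorphism φ : Γ₁(N) → (ℂ, +) decomposes according to central characters: there exist functions f_ψ : Γ₀(N) → ℂ, one for each Dirichlet character ψ modulo N, such that each f_ψ satisfies the ψ-crossed homomorphism property f_ψ(γ₁γ₂) = f_ψ(γ₁) + ψ(d(γ₁))·f_ψ(γ₂) for all γ₁, γ₂ ∈ Γ₀(N), and φ(γ) = Σ_ψ f_ψ(γ) for every γ ∈ Γ₁(N). -/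
open scoped BigOperators

/-- Shapiro-type decomposition: an additive function on the kernel of a surjection
`δ : G → (ℤ/Nℤ)ˣ` is a sum of `ψ`-crossed homomorphisms on `G`. -/
theorem exists_crossed_decomposition {G : Type*} [Group G] {N : ℕ} [NeZero N]
    (δ : G →* (ZMod N)ˣ) (hδ : Function.Surjective δ) (φ : G → ℂ)
    (hφ : ∀ x ∈ δ.ker, ∀ y ∈ δ.ker, φ (x * y) = φ x + φ y) :
    ∃ f : DirichletCharacter ℂ N → G → ℂ,
      (∀ ψ g h, f ψ (g * h) = f ψ g + ψ (δ g) * f ψ h) ∧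
      ∀ g ∈ δ.ker, φ g = ∑ ψ, f ψ g := by
  obtain ⟨s, hs⟩ := hδ.hasRightInverse
  let F : G → (ZMod N)ˣ → ℂ := fun g a => φ (s a * g * (s (a * δ g))⁻¹)
  have hF : ∀ g h a, F (g * h) a = F g a + F h (a * δ g) := by
    intro g h a
    simp only [F]
    rw [← hφ _ (by simp [MonoidHom.mem_ker, hs _]) _ (by simp [MonoidHom.mem_ker, hs _])]
    congr 1
    simp only [map_mul]
    group
  have hφ1 : φ 1 = 0 := by simpa using hφ 1 (one_mem _) 1 (one_mem _)
  have hF1 : ∀ g ∈ δ.ker, F g 1 = φ g := by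
    intro g hg
    have h1 : s 1 ∈ δ.ker := hs 1
    have hδg : δ g = 1 := hg
    have hinv : φ (s 1) + φ (s 1)⁻¹ = 0 := by
      rw [← hφ _ h1 _ (inv_mem h1), mul_inv_cancel, hφ1]
    simp only [F, hδg, mul_one]
    rw [hφ _ (mul_mem h1 hg) _ (inv_mem h1), hφ _ h1 _ hg]
    linear_combination hinv
  have hN : (N.totient : ℂ) ≠ 0 := by
    exact_mod_cast (Nat.totient_pos.2 (NeZero.pos N)).ne'
  refine ⟨fun ψ g => (N.totient : ℂ)⁻¹ * ∑ a : (ZMod N)ˣ, ψ ((a⁻¹ : (ZMod N)ˣ) : ZMod N) * F g a,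
    ?_, ?_⟩
  · intro ψ g h
    have key : ∑ a : (ZMod N)ˣ, ψ ((a⁻¹ : (ZMod N)ˣ) : ZMod N) * F h (a * δ g) =
        ψ (δ g) * ∑ a : (ZMod N)ˣ, ψ ((a⁻¹ : (ZMod N)ˣ) : ZMod N) * F h a := by
      rw [Finset.mul_sum]
      refine Fintype.sum_equiv (Equiv.mulRight (δ g)) _ _ fun a => ?_
      rw [← mul_assoc, ← map_mul, ← Units.val_mul]
      simp
    simp only [hF, mul_add, Finset.sum_add_distrib, key]
    ring
  · intro g hg
    have orth : ∀ a : (ZMod N)ˣ, ∑ ψ : DirichletCharacter ℂ N, ψ ((a⁻¹ : (ZMod N)ˣ) : ZMod N) =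
        if a = 1 then (N.totient : ℂ) else 0 := by
      intro a
      have := DirichletCharacter.sum_char_inv_mul_char_eq ℂ a.isUnit 1
      simpa [Units.val_eq_one] using this
    rw [← Finset.mul_sum, Finset.sum_comm]
    simp only [← Finset.sum_mul, orth, ite_mul, zero_mul]
    rw [Finset.sum_ite_eq' Finset.univ (1 : (ZMod N)ˣ)]
    simp [hF1 g hg, hN]

/-- Every unit modulo `N` is the lower-right entry of an element of `Γ₀(N)`. -/
theorem Gamma0Map_toHomUnits_surjective (N : ℕ) [NeZero N] :
    Function.Surjective (CongruenceSubgroup.Gamma0Map N).toHomUnits := by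
  intro u
  have hc : IsCoprime ((u : ZMod N).val : ℤ) (N : ℤ) :=
    Nat.isCoprime_iff_coprime.2 (ZMod.val_coe_unit_coprime u)
  obtain ⟨a, b, hab⟩ := hc
  let γ : Matrix.SpecialLinearGroup (Fin 2) ℤ :=
    ⟨!![a, -b; (N : ℤ), ((u : ZMod N).val : ℤ)], by
      rw [Matrix.det_fin_two_of]; linear_combination hab⟩
  have hγ : γ ∈ CongruenceSubgroup.Gamma0 N := by
    rw [CongruenceSubgroup.Gamma0_mem]
    simp [γ]
  refine ⟨⟨γ, hγ⟩, Units.ext ?_⟩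
  simp [CongruenceSubgroup.Gamma0Map, γ]

/-- Every group homomorphism `φ : Γ₁(N) → (ℂ, +)` decomposes according to central
characters: there are `ψ`-crossed homomorphisms `f_ψ` on `Γ₀(N)`, one for each Dirichlet
character `ψ` mod `N`, with `φ = Σ_ψ f_ψ` on `Γ₁(N)`. -/
theorem hom_decomposes_by_central_character (N : ℕ) [NeZero N]
    (φ : Matrix.SpecialLinearGroup (Fin 2) ℤ → ℂ)
    (hφ : ∀ x ∈ CongruenceSubgroup.Gamma1 N, ∀ y ∈ CongruenceSubgroup.Gamma1 N,
      φ (x * y) = φ x + φ y) :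
    ∃ f : DirichletCharacter ℂ N → Matrix.SpecialLinearGroup (Fin 2) ℤ → ℂ,
      (∀ ψ, ∀ γ₁ ∈ CongruenceSubgroup.Gamma0 N, ∀ γ₂ ∈ CongruenceSubgroup.Gamma0 N,
        f ψ (γ₁ * γ₂) = f ψ γ₁ + ψ (dmap N γ₁) * f ψ γ₂) ∧
      (∀ γ ∈ CongruenceSubgroup.Gamma1 N,
        φ γ = ∑ ψ : DirichletCharacter ℂ N, f ψ γ) := by
  classical
  let δ := (CongruenceSubgroup.Gamma0Map N).toHomUnits
  have hker : ∀ x : CongruenceSubgroup.Gamma0 N,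
      x ∈ δ.ker ↔ (x : Matrix.SpecialLinearGroup (Fin 2) ℤ) ∈ CongruenceSubgroup.Gamma1 N := by
    intro x
    rw [CongruenceSubgroup.Gamma1_mem, ← CongruenceSubgroup.Gamma1_to_Gamma0_mem,
      CongruenceSubgroup.Gamma1', MonoidHom.mem_ker, MonoidHom.mem_ker, Units.ext_iff]
    rfl
  obtain ⟨f, hf, hsum⟩ := exists_crossed_decomposition δ (Gamma0Map_toHomUnits_surjective N)
    (fun x => φ x) fun x hx y hy => hφ x ((hker x).1 hx) y ((hker y).1 hy)
  refine ⟨fun ψ γ => if h : γ ∈ CongruenceSubgroup.Gamma0 N then f ψ ⟨γ, h⟩ else 0, ?_, ?_⟩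
  · intro ψ γ₁ h₁ γ₂ h₂
    simp only [dif_pos h₁, dif_pos h₂, dif_pos (mul_mem h₁ h₂)]
    exact hf ψ ⟨γ₁, h₁⟩ ⟨γ₂, h₂⟩
  · intro γ hγ
    have h₀ : γ ∈ CongruenceSubgroup.Gamma0 N := CongruenceSubgroup.Gamma1_in_Gamma0 N hγ
    simp only [dif_pos h₀]
    convert hsum ⟨γ, h₀⟩ ((hker ⟨γ, h₀⟩).2 hγ)
end
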